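/- arXiv:2509.13912 — 8 statements merged into one kernel-verified Lean document; each statement's English description precedes it below -/
import Mathlib

section
/- Let k be an infinite field and A an associative unital k-algebra that is finite-dimensional as a k-vector space. Let V be a left A-module that is cyclic, i.e. there exists v₀ ∈ V with Submodule.span A {v₀} = ⊤. If r ∈ A is such that the k-linear map V → V given by v ↦ r • v is bijective, then there exists a unit r̃ ∈ Aˣ such that r̃ • v = r • v for every v ∈ V. -/
open Polynomial in
/-- An element `r` of an integral algebra over a field is annihilated by `X ^ n * q` for some `n`
and some polynomial `q` such that `r + q(r)` is a unit. -/
theorem exists_pow_mul_aeval_eq_zero_and_isUnit_add_aeval {k A : Type*} [Field k] [Ring A]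
    [Algebra k A] {r : A} (hr : IsIntegral k r) :
    ∃ (n : ℕ) (q : k[X]), r ^ n * aeval r q = 0 ∧ IsUnit (r + aeval r q) := by
  obtain ⟨q, hq, hXq⟩ :=
    exists_eq_pow_rootMultiplicity_mul_and_not_dvd (minpoly k r) (minpoly.ne_zero hr) 0
  rw [C_0, sub_zero] at hq hXq
  have hmin := minpoly.aeval k r
  have hcop : IsCoprime X q := irreducible_X.coprime_iff_not_dvd.2 hXq
  have hX : IsCoprime (X + q) X := by
    simpa [add_comm] using hcop.symm.add_mul_left_left 1
  have hadd : IsCoprime (X + q) q := by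
    simpa using hcop.add_mul_left_left 1
  obtain ⟨a, b, hab⟩ := hq ▸ hX.pow_right.mul_right hadd
  have h : aeval r a * (r + aeval r q) = 1 := by
    simpa [hmin] using congrArg (aeval r) hab
  have h' : (r + aeval r q) * aeval r a = 1 := by
    rw [mul_comm] at hab
    simpa [hmin] using congrArg (aeval r) hab
  refine ⟨(minpoly k r).rootMultiplicity 0, q, ?_, ⟨⟨_, _, h', h⟩, rfl⟩⟩
  simpa [hmin] using (congrArg (aeval r) hq).symm

/-- Let `A` be a finite-dimensional algebra over an infinite field `k`, and let `V` be a
cyclic left `A`-module. If `r : A` acts bijectively on `V`, then there is a unit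
`rt ∈ Aˣ` acting on `V` in the same way as `r`. -/
theorem cyclic_generators_related_by_invertible
    (k : Type*) [Field k] [Infinite k]
    (A : Type*) [Ring A] [Algebra k A] [FiniteDimensional k A]
    (V : Type*) [AddCommGroup V] [Module A V]
    (v₀ : V) (hv : Submodule.span A {v₀} = ⊤)
    (r : A) (hr : Function.Bijective (fun v : V => r • v)) :
    ∃ rt : Aˣ, ∀ v : V, (rt : A) • v = r • v := by
  obtain ⟨n, q, hq, u, hu⟩ :=
    exists_pow_mul_aeval_eq_zero_and_isUnit_add_aeval (Algebra.IsIntegral.isIntegral (R := k) r)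
  refine ⟨u, fun v => ?_⟩
  have hinj : Function.Injective (fun v : V => r ^ n • v) := by
    simpa only [smul_iterate] using hr.injective.iterate n
  have hqv : Polynomial.aeval r q • v = 0 :=
    hinj (by simp only [smul_zero, ← mul_smul, hq, zero_smul])
  rw [hu, add_smul, hqv, add_zero]
end

section
/- (Mukai lemma.) Work in K = the homotopy category of cochain complexes of k-vector spaces, i.e. HomotopyCategory (ModuleCat k) (ComplexShape.up ℤ), which is a k-linear pretriangulated category; for objects A, B and n : ℤ write Hom^n(A,B) for the k-module of morphisms A ⟶ B⟦n⟧. Let A₁ ⟶ X ⟶ A₂ ⟶ A₁⟦1⟧ be a distinguished triangle in K. Assume Hom^0(A₁, A₂) = 0 and Hom^2(A₂, A₁) = 0, and assume the k-modules Hom^1(A₁,A₁), Hom^1(A₂,A₂) and Hom^1(X,X) are finite-dimensional over k. Then finrank_k Hom^1(A₁,A₁) + finrank_k Hom^1(A₂,A₂) ≤ finrank_k Hom^1(X,X). -/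
open CategoryTheory Pretriangulated

section MukaiLemma

open Limits

variable {C : Type*} [Category C] [Preadditive C] [HasZeroObject C] [HasShift C ℤ]
  [∀ n : ℤ, (shiftFunctor C n).Additive] [Pretriangulated C]

/-- If `Hom^2(T.obj₃, T.obj₁) = 0`, any degree one endomorphisms of the outer terms of a
distinguished triangle extend to a degree one endomorphism of the middle term. -/
theorem exists_degree_one_endomorphism_of_distinguished (T : Triangle C) (hT : T ∈ distTriang C)
    (h2 : ∀ φ : T.obj₃ ⟶ T.obj₁⟦(2 : ℤ)⟧, φ = 0)
    (a : T.obj₁ ⟶ T.obj₁⟦(1 : ℤ)⟧) (c : T.obj₃ ⟶ T.obj₃⟦(1 : ℤ)⟧) :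
    ∃ b : T.obj₂ ⟶ T.obj₂⟦(1 : ℤ)⟧,
      T.mor₁ ≫ b = a ≫ T.mor₁⟦(1 : ℤ)⟧' ∧ b ≫ T.mor₂⟦(1 : ℤ)⟧' = T.mor₂ ≫ c := by
  have hzero (φ : T.obj₃ ⟶ T.obj₁⟦(1 : ℤ)⟧⟦(1 : ℤ)⟧) : φ = 0 := by
    rw [← cancel_mono ((shiftFunctorAdd' C (1 : ℤ) 1 2 (by norm_num)).inv.app T.obj₁), zero_comp]
    exact h2 _
  obtain ⟨b, hb₁, hb₂⟩ := complete_distinguished_triangle_morphism₂ T _ hT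
    (Triangle.shift_distinguished T hT 1) a c ((hzero _).trans (hzero _).symm)
  change T.obj₂ ⟶ T.obj₂⟦(1 : ℤ)⟧ at b
  change T.mor₁ ≫ b = a ≫ (Int.negOnePow 1 • T.mor₁⟦(1 : ℤ)⟧') at hb₁
  change T.mor₂ ≫ c = b ≫ (Int.negOnePow 1 • T.mor₂⟦(1 : ℤ)⟧') at hb₂
  refine ⟨-b, ?_, ?_⟩
  · simp [hb₁, Int.negOnePow_one, Units.smul_def]
  · simp [hb₂, Int.negOnePow_one, Units.smul_def]

/-- If `Hom(T.obj₁, T.obj₃) = 0`, a degree one endomorphism of `T.obj₁` that becomes zero in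
`T.obj₂⟦1⟧` is zero. -/
theorem eq_zero_of_comp_mor₁_shift_eq_zero (T : Triangle C) (hT : T ∈ distTriang C)
    (h0 : ∀ φ : T.obj₁ ⟶ T.obj₃, φ = 0) (a : T.obj₁ ⟶ T.obj₁⟦(1 : ℤ)⟧)
    (ha : a ≫ T.mor₁⟦(1 : ℤ)⟧' = 0) : a = 0 := by
  obtain ⟨u, rfl⟩ := T.coyoneda_exact₁ hT a ha
  rw [h0 u, zero_comp]

/-- If `Hom(T.obj₁, T.obj₃) = 0`, a degree one endomorphism of `T.obj₃` that becomes zero on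
`T.obj₂` is zero. -/
theorem eq_zero_of_mor₂_comp_eq_zero (T : Triangle C) (hT : T ∈ distTriang C)
    (h0 : ∀ φ : T.obj₁ ⟶ T.obj₃, φ = 0) (c : T.obj₃ ⟶ T.obj₃⟦(1 : ℤ)⟧)
    (hc : T.mor₂ ≫ c = 0) : c = 0 := by
  obtain ⟨u, rfl⟩ := T.yoneda_exact₃ hT c hc
  obtain ⟨v, rfl⟩ := (shiftFunctor C (1 : ℤ)).map_surjective u
  rw [h0 v, Functor.map_zero, comp_zero]

/-- The **Mukai lemma** for a distinguished triangle in a linear pretriangulated category. -/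
theorem finrank_add_finrank_le_of_distinguished (k : Type*) [Field k] [Linear k C]
    (T : Triangle C) (hT : T ∈ distTriang C)
    (h0 : ∀ φ : T.obj₁ ⟶ T.obj₃, φ = 0) (h2 : ∀ φ : T.obj₃ ⟶ T.obj₁⟦(2 : ℤ)⟧, φ = 0)
    [FiniteDimensional k (T.obj₁ ⟶ T.obj₁⟦(1 : ℤ)⟧)]
    [FiniteDimensional k (T.obj₃ ⟶ T.obj₃⟦(1 : ℤ)⟧)]
    [FiniteDimensional k (T.obj₂ ⟶ T.obj₂⟦(1 : ℤ)⟧)] :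
    Module.finrank k (T.obj₁ ⟶ T.obj₁⟦(1 : ℤ)⟧) + Module.finrank k (T.obj₃ ⟶ T.obj₃⟦(1 : ℤ)⟧)
      ≤ Module.finrank k (T.obj₂ ⟶ T.obj₂⟦(1 : ℤ)⟧) := by
  let R : Submodule k ((T.obj₂ ⟶ T.obj₂⟦(1 : ℤ)⟧) ×
      ((T.obj₁ ⟶ T.obj₁⟦(1 : ℤ)⟧) × (T.obj₃ ⟶ T.obj₃⟦(1 : ℤ)⟧))) :=
    { carrier := {x | T.mor₁ ≫ x.1 = x.2.1 ≫ T.mor₁⟦(1 : ℤ)⟧' ∧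
        x.1 ≫ T.mor₂⟦(1 : ℤ)⟧' = T.mor₂ ≫ x.2.2}
      add_mem' := by
        rintro x y ⟨hx₁, hx₂⟩ ⟨hy₁, hy₂⟩
        simp [hx₁, hx₂, hy₁, hy₂]
      zero_mem' := by simp
      smul_mem' := by
        rintro r x ⟨hx₁, hx₂⟩
        simp [hx₁, hx₂] }
  let p : R →ₗ[k] (T.obj₂ ⟶ T.obj₂⟦(1 : ℤ)⟧) := LinearMap.fst k _ _ ∘ₗ R.subtype
  let q : R →ₗ[k] (T.obj₁ ⟶ T.obj₁⟦(1 : ℤ)⟧) × (T.obj₃ ⟶ T.obj₃⟦(1 : ℤ)⟧) :=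
    LinearMap.snd k _ _ ∘ₗ R.subtype
  have hp : Function.Injective p := by
    rw [injective_iff_map_eq_zero]
    rintro ⟨⟨b, a, c⟩, hb₁, hb₂⟩ (rfl : b = 0)
    have ha : a = 0 := eq_zero_of_comp_mor₁_shift_eq_zero T hT h0 a (by simpa using hb₁.symm)
    have hc : c = 0 := eq_zero_of_mor₂_comp_eq_zero T hT h0 c (by simpa using hb₂.symm)
    subst ha hc
    rfl
  have hq : Function.Surjective q := by
    rintro ⟨a, c⟩
    obtain ⟨b, hb⟩ := exists_degree_one_endomorphism_of_distinguished T hT h2 a c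
    exact ⟨⟨(b, a, c), hb⟩, rfl⟩
  rw [← Module.finrank_prod]
  exact (LinearMap.finrank_le_finrank_of_surjective hq).trans
    (LinearMap.finrank_le_finrank_of_injective hp)

end MukaiLemma

/-- **Mukai lemma** in the homotopy category of cochain complexes of `k`-vector spaces.
If `A₁ ⟶ X ⟶ A₂ ⟶ A₁⟦1⟧` is a distinguished triangle with `Hom^0(A₁, A₂) = 0` and
`Hom^2(A₂, A₁) = 0`, then
`dim Hom^1(A₁,A₁) + dim Hom^1(A₂,A₂) ≤ dim Hom^1(X,X)`. -/
theorem mukai_lemma (k : Type) [Field k]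
    (A₁ X A₂ : HomotopyCategory (ModuleCat k) (ComplexShape.up ℤ))
    (f : A₁ ⟶ X) (g : X ⟶ A₂) (h : A₂ ⟶ A₁⟦(1 : ℤ)⟧)
    (hT : Triangle.mk f g h ∈
      distTriang (HomotopyCategory (ModuleCat k) (ComplexShape.up ℤ)))
    (h0 : ∀ φ : A₁ ⟶ A₂⟦(0 : ℤ)⟧, φ = 0)
    (h2 : ∀ φ : A₂ ⟶ A₁⟦(2 : ℤ)⟧, φ = 0)
    [FiniteDimensional k (A₁ ⟶ A₁⟦(1 : ℤ)⟧)]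
    [FiniteDimensional k (A₂ ⟶ A₂⟦(1 : ℤ)⟧)]
    [FiniteDimensional k (X ⟶ X⟦(1 : ℤ)⟧)] :
    Module.finrank k (A₁ ⟶ A₁⟦(1 : ℤ)⟧) + Module.finrank k (A₂ ⟶ A₂⟦(1 : ℤ)⟧)
      ≤ Module.finrank k (X ⟶ X⟦(1 : ℤ)⟧) := by
  have : FiniteDimensional k ((Triangle.mk f g h).obj₁ ⟶ (Triangle.mk f g h).obj₁⟦(1 : ℤ)⟧) :=
    inferInstanceAs (FiniteDimensional k (A₁ ⟶ A₁⟦(1 : ℤ)⟧))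
  have : FiniteDimensional k ((Triangle.mk f g h).obj₃ ⟶ (Triangle.mk f g h).obj₃⟦(1 : ℤ)⟧) :=
    inferInstanceAs (FiniteDimensional k (A₂ ⟶ A₂⟦(1 : ℤ)⟧))
  have : FiniteDimensional k ((Triangle.mk f g h).obj₂ ⟶ (Triangle.mk f g h).obj₂⟦(1 : ℤ)⟧) :=
    inferInstanceAs (FiniteDimensional k (X ⟶ X⟦(1 : ℤ)⟧))
  refine finrank_add_finrank_le_of_distinguished k (Triangle.mk f g h) hT (fun φ ↦ ?_) h2
  exact (cancel_mono ((shiftFunctorZero _ ℤ).inv.app A₂)).1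
    ((h0 _).trans Limits.zero_comp.symm)
end

section
/- Work in K = the homotopy category of cochain complexes of k-vector spaces, i.e. HomotopyCategory (ModuleCat k) (ComplexShape.up ℤ), which is a k-linear pretriangulated category; for objects A, B and n : ℤ write Hom^n(A,B) for the k-module of morphisms A ⟶ B⟦n⟧. Let A₁ ⟶ X ⟶ A₂ ⟶(α) A₁⟦1⟧ be a distinguished triangle in K with connecting morphism α : A₂ ⟶ A₁⟦1⟧. Assume Hom^0(A₁, A₂) = 0 and Hom^1(X, X) = 0. Then α generates Hom(A₂, A₁⟦1⟧) as a bimodule for post-composition by End(A₁⟦1⟧) and pre-composition by End(A₂); concretely, the k-linear span of the set { g ≫ α ≫ f | g : A₂ ⟶ A₂, f : A₁⟦1⟧ ⟶ A₁⟦1⟧ } is all of Hom(A₂, A₁⟦1⟧). -/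
open CategoryTheory Pretriangulated

/-- In a pretriangulated category, if `A₁ ⟶ X ⟶ A₂ ⟶ A₁⟦1⟧` is distinguished with
`Hom(A₁, A₂) = 0` and `Hom(X, X⟦1⟧) = 0`, then every morphism `A₂ ⟶ A₁⟦1⟧` is the sum of a
precomposite and a postcomposite of the connecting morphism. -/
theorem exists_eq_comp_mor₃_add_mor₃_comp {C : Type*} [Category C] [Preadditive C]
    [Limits.HasZeroObject C] [HasShift C ℤ] [∀ n : ℤ, (shiftFunctor C n).Additive]
    [Pretriangulated C] (T : Triangle C) (hT : T ∈ distTriang C)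
    (h0 : ∀ φ : T.obj₁ ⟶ T.obj₃, φ = 0) (h1 : ∀ φ : T.obj₂ ⟶ T.obj₂⟦(1 : ℤ)⟧, φ = 0)
    (φ : T.obj₃ ⟶ T.obj₁⟦(1 : ℤ)⟧) :
    ∃ (g : T.obj₃ ⟶ T.obj₃) (f : T.obj₁⟦(1 : ℤ)⟧ ⟶ T.obj₁⟦(1 : ℤ)⟧),
      φ = g ≫ T.mor₃ + T.mor₃ ≫ f := by
  obtain ⟨β, hβ⟩ := T.yoneda_exact₃ hT (φ ≫ T.mor₁⟦(1 : ℤ)⟧') (h1 _)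
  obtain ⟨b, rfl⟩ := (shiftFunctor C (1 : ℤ)).map_surjective β
  obtain ⟨f, rfl⟩ := T.coyoneda_exact₂ hT b (h0 _)
  obtain ⟨g, hg⟩ := T.coyoneda_exact₁ hT (φ - T.mor₃ ≫ f⟦(1 : ℤ)⟧') (by
    rw [Preadditive.sub_comp, hβ, Functor.map_comp, Category.assoc, sub_self])
  exact ⟨g, f⟦(1 : ℤ)⟧', sub_eq_iff_eq_add.mp hg⟩

/-- In the homotopy category of cochain complexes of `k`-vector spaces, suppose
`A₁ ⟶ X ⟶ A₂ ⟶(α) A₁⟦1⟧` is a distinguished triangle with `Hom^0(A₁, A₂) = 0` and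
`Hom^1(X, X) = 0`.  Then the connecting morphism `α` generates `Hom(A₂, A₁⟦1⟧)` as a
bimodule for post-composition by `End (A₁⟦1⟧)` and pre-composition by `End A₂`: the
`k`-linear span of `{ g ≫ α ≫ f }` is everything. -/
theorem bimodule_generator (k : Type) [Field k]
    (A₁ X A₂ : HomotopyCategory (ModuleCat k) (ComplexShape.up ℤ))
    (u : A₁ ⟶ X) (v : X ⟶ A₂) (α : A₂ ⟶ A₁⟦(1 : ℤ)⟧)
    (hT : Triangle.mk u v α ∈
      distTriang (HomotopyCategory (ModuleCat k) (ComplexShape.up ℤ)))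
    (h0 : ∀ φ : A₁ ⟶ A₂⟦(0 : ℤ)⟧, φ = 0)
    (h1 : ∀ φ : X ⟶ X⟦(1 : ℤ)⟧, φ = 0) :
    Submodule.span k
      {x : A₂ ⟶ A₁⟦(1 : ℤ)⟧ |
        ∃ (g : A₂ ⟶ A₂) (f : A₁⟦(1 : ℤ)⟧ ⟶ A₁⟦(1 : ℤ)⟧), x = g ≫ α ≫ f} = ⊤ := by
  refine eq_top_iff.mpr fun φ _ => ?_
  obtain ⟨g, f, rfl⟩ := exists_eq_comp_mor₃_add_mor₃_comp (Triangle.mk u v α) hT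
    (fun ψ => (cancel_mono ((shiftFunctorZero _ ℤ).inv.app A₂)).mp
      ((h0 _).trans Limits.zero_comp.symm))
    h1 φ
  refine Submodule.add_mem _ (Submodule.subset_span ⟨g, 𝟙 _, ?_⟩)
    (Submodule.subset_span ⟨𝟙 _, f, ?_⟩)
  · rw [Category.comp_id]; rfl
  · rw [Category.id_comp]; rfl
end

section
/- Let k be an infinite field and C a k-linear pretriangulated category (preadditive, with k-linear Hom modules, shift by ℤ, and a pretriangulated structure). Let A₁, A₂ be objects of C and let α, β : A₂ ⟶ A₁⟦1⟧ be morphisms fitting into distinguished triangles A₂ ⟶(α) A₁⟦1⟧ ⟶ X ⟶ A₂⟦1⟧ and A₂ ⟶(β) A₁⟦1⟧ ⟶ X' ⟶ A₂⟦1⟧. Assume that End(A₁⟦1⟧) and Hom(A₂, A₁⟦1⟧) are finite-dimensional k-vector spaces, and that both α and β generate Hom(A₂, A₁⟦1⟧) as a left module over End(A₁⟦1⟧) acting by post-composition; concretely, the k-linear span of { α ≫ f | f : A₁⟦1⟧ ⟶ A₁⟦1⟧ } and the k-linear span of { β ≫ f | f : A₁⟦1⟧ ⟶ A₁⟦1⟧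 } each equal Hom(A₂, A₁⟦1⟧). Then the two distinguished triangles are isomorphic; in particular X ≅ X'. -/
open CategoryTheory Pretriangulated CategoryTheory.Linear

/-- An element of a finite-dimensional algebra over a field has finite spectrum. -/
theorem spectrum.finite_of_finiteDimensional {k A : Type*} [Field k] [Ring A] [Algebra k A]
    [FiniteDimensional k A] (a : A) : (spectrum k a).Finite := by
  cases subsingleton_or_nontrivial A
  · simp
  · refine (Polynomial.rootSet_finite (minpoly k a) k).subset fun r hr => ?_
    have h := spectrum.subset_polynomial_aeval a (minpoly k a) (Set.mem_image_of_mem _ hr)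
    rw [minpoly.aeval, spectrum.zero_eq, Set.mem_singleton_iff] at h
    rw [Polynomial.mem_rootSet]
    exact ⟨minpoly.ne_zero (Algebra.IsIntegral.isIntegral a), by simpa using h⟩

/-- For elements `a`, `b` of a finite-dimensional algebra over an infinite field, the elements
`r - a` and `r • b - 1` are simultaneously invertible for some scalar `r`. -/
theorem exists_isUnit_algebraMap_sub_and_isUnit_smul_sub_one (k : Type*) {A : Type*} [Field k]
    [Infinite k] [Ring A] [Algebra k A] [FiniteDimensional k A] (a b : A) :
    ∃ r : k, IsUnit (algebraMap k A r - a) ∧ IsUnit (r • b - 1) := by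
  obtain ⟨r, hr⟩ := (((spectrum.finite_of_finiteDimensional (k := k) a).union
    ((spectrum.finite_of_finiteDimensional (k := k) b).preimage
      inv_injective.injOn)).union (Set.finite_singleton (0 : k))).exists_notMem
  simp only [Set.mem_union, Set.mem_preimage, Set.mem_singleton_iff, not_or] at hr
  obtain ⟨⟨ha, hb⟩, h0⟩ := hr
  refine ⟨r, spectrum.notMem_iff.mp ha, ?_⟩
  have h := ((spectrum.notMem_iff.mp hb).neg).smul (Units.mk0 r h0)
  convert h using 1
  simp [Units.smul_def, smul_sub, Algebra.algebraMap_eq_smul_one, smul_smul, h0]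

namespace CategoryTheory.Linear

/-- If the postcomposites of `α` span the space of morphisms, then every morphism is a
postcomposite of `α`. -/
theorem exists_comp_eq_of_span_eq_top {k C : Type*} [Field k] [Category C] [Preadditive C]
    [Linear k C] {X Y Z : C} {α : X ⟶ Y}
    (hα : Submodule.span k {x : X ⟶ Z | ∃ f : Y ⟶ Z, x = α ≫ f} = ⊤) (x : X ⟶ Z) :
    ∃ f : Y ⟶ Z, α ≫ f = x := by
  have h : Submodule.span k {x : X ⟶ Z | ∃ f : Y ⟶ Z, x = α ≫ f} ≤
      LinearMap.range (leftComp k Z α) :=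
    Submodule.span_le.mpr (by rintro _ ⟨f, rfl⟩; exact ⟨f, rfl⟩)
  exact h (hα ▸ Submodule.mem_top)

/-- Two morphisms that factor through each other by endomorphisms of a common target with
finite-dimensional endomorphism algebra over an infinite field differ by an automorphism of
that target. -/
theorem exists_iso_comp_eq (k : Type*) {C : Type*} [Field k] [Infinite k] [Category C]
    [Preadditive C] [Linear k C] {X Y : C} [FiniteDimensional k (Y ⟶ Y)] {α β : X ⟶ Y}
    (hαβ : ∃ f : Y ⟶ Y, α ≫ f = β) (hβα : ∃ f : Y ⟶ Y, β ≫ f = α) :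
    ∃ e : Y ≅ Y, α ≫ e.hom = β := by
  obtain ⟨a, ha⟩ := hαβ
  obtain ⟨b, hb⟩ := hβα
  have : FiniteDimensional k (End Y) := inferInstanceAs (FiniteDimensional k (Y ⟶ Y))
  obtain ⟨r, hg, hh⟩ := exists_isUnit_algebraMap_sub_and_isUnit_smul_sub_one k
    (A := End Y) a b
  rw [isUnit_iff_isIso, Algebra.algebraMap_eq_smul_one] at hg
  rw [isUnit_iff_isIso] at hh
  let g : Y ⟶ Y := r • 𝟙 Y - a
  let h : Y ⟶ Y := r • b - 𝟙 Y
  have : IsIso g := hg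
  have : IsIso h := hh
  have hgh : α ≫ g = β ≫ h := by
    simp [g, h, Preadditive.comp_sub, ha, hb]
  exact ⟨asIso g ≪≫ (asIso h).symm, by simp [reassoc_of% hgh]⟩

end CategoryTheory.Linear

/-- Let `C` be a `k`-linear pretriangulated category over an infinite field `k`.
Suppose `α, β : A₂ ⟶ A₁⟦1⟧` fit into distinguished triangles
`A₂ ⟶(α) A₁⟦1⟧ ⟶ X ⟶ A₂⟦1⟧` and `A₂ ⟶(β) A₁⟦1⟧ ⟶ X' ⟶ A₂⟦1⟧`, that
`End (A₁⟦1⟧)` and `Hom (A₂, A₁⟦1⟧)` are finite-dimensional over `k`, and that both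
`α` and `β` generate `Hom (A₂, A₁⟦1⟧)` as a left `End (A₁⟦1⟧)`-module (acting by
post-composition).  Then the two triangles are isomorphic; in particular `X ≅ X'`. -/
theorem left_module_generator_triangles_iso
    (k : Type*) [Field k] [Infinite k]
    (C : Type*) [Category C] [Preadditive C] [CategoryTheory.Linear k C]
    [Limits.HasZeroObject C] [HasShift C ℤ]
    [∀ n : ℤ, (shiftFunctor C n).Additive] [Pretriangulated C]
    (A₁ A₂ X X' : C)
    (α β : A₂ ⟶ A₁⟦(1 : ℤ)⟧)
    (u : A₁⟦(1 : ℤ)⟧ ⟶ X) (v : X ⟶ A₂⟦(1 : ℤ)⟧)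
    (u' : A₁⟦(1 : ℤ)⟧ ⟶ X') (v' : X' ⟶ A₂⟦(1 : ℤ)⟧)
    (hT : Triangle.mk α u v ∈ distTriang C)
    (hT' : Triangle.mk β u' v' ∈ distTriang C)
    [FiniteDimensional k (A₁⟦(1 : ℤ)⟧ ⟶ A₁⟦(1 : ℤ)⟧)]
    [FiniteDimensional k (A₂ ⟶ A₁⟦(1 : ℤ)⟧)]
    (hα : Submodule.span k
      {x : A₂ ⟶ A₁⟦(1 : ℤ)⟧ | ∃ f : A₁⟦(1 : ℤ)⟧ ⟶ A₁⟦(1 : ℤ)⟧, x = α ≫ f} = ⊤)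
    (hβ : Submodule.span k
      {x : A₂ ⟶ A₁⟦(1 : ℤ)⟧ | ∃ f : A₁⟦(1 : ℤ)⟧ ⟶ A₁⟦(1 : ℤ)⟧, x = β ≫ f} = ⊤) :
    Nonempty (Triangle.mk α u v ≅ Triangle.mk β u' v') ∧ Nonempty (X ≅ X') := by
  obtain ⟨e, he⟩ := exists_iso_comp_eq k (exists_comp_eq_of_span_eq_top hα β)
    (exists_comp_eq_of_span_eq_top hβ α)
  let E : Triangle.mk α u v ≅ Triangle.mk β u' v' :=
    isoTriangleOfIso₁₂ _ _ hT hT' (Iso.refl A₂) e (he.trans (Category.id_comp β).symm)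
  exact ⟨⟨E⟩, ⟨Triangle.π₃.mapIso E⟩⟩
end

section
/- (Base case of uniqueness of extensions with given factors.) Let k be an infinite field and work in K = the homotopy category of cochain complexes of k-vector spaces, i.e. HomotopyCategory (ModuleCat k) (ComplexShape.up ℤ), which is a k-linear pretriangulated category; for objects A, B and n : ℤ write Hom^n(A,B) for the k-module of morphisms A ⟶ B⟦n⟧. Let A₀ ⟶ X ⟶ A₁ ⟶(α) A₀⟦1⟧ and A₀ ⟶ W ⟶ A₁ ⟶(β) A₀⟦1⟧ be distinguished triangles in K. Assume: Hom^0(A₀, A₁) = 0; Hom^1(X, X) = 0 and Hom^1(W, W) = 0; End(A₁) is one-dimensional over k (finrank_k End(A₁) = 1); and End(A₀⟦1⟧) and Hom(A₁, A₀⟦1⟧) are finite-dimensional over k. Then the two triangles are isomorphic; in particular X ≅ W. -/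
open CategoryTheory Pretriangulated

namespace CategoryTheory

open Limits Category

/-- In a finite-dimensional algebra over a field, `1 + t • a` is a unit for all but finitely
many scalars `t`. -/
lemma finite_setOf_not_isUnit_one_add_smul (k : Type*) [Field k] {R : Type*} [Ring R]
    [Algebra k R] [FiniteDimensional k R] (a : R) :
    {t : k | ¬ IsUnit (1 + t • a)}.Finite := by
  have hfin : (spectrum k a).Finite := by
    refine (Module.End.finite_spectrum (Algebra.lmul k R a)).subset fun t ht => ?_
    rw [spectrum.mem_iff] at ht ⊢
    rwa [← (Algebra.lmul k R).commutes, ← map_sub, Algebra.lmul_isUnit_iff]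
  refine (hfin.image fun t => -t⁻¹).subset fun t ht => ?_
  have ht0 : t ≠ 0 := by
    rintro rfl
    simp at ht
  refine ⟨-t⁻¹, ?_, by simp⟩
  rw [spectrum.mem_iff]
  intro hu
  apply ht
  have h : 1 + t • a = (-Units.mk0 t ht0) • (algebraMap k R (-t⁻¹) - a) := by
    simp [Units.smul_def, Algebra.algebraMap_eq_smul_one, smul_sub, smul_smul, ht0]
  rw [h]
  exact hu.smul _

/-- If the endomorphism algebra of `B` is finite-dimensional over an infinite field, two morphisms
to `B` which factor through each other differ by an automorphism of `B`. -/
lemma exists_iso_comp_eq {k : Type*} [Field k] [Infinite k] {C : Type*} [Category* C]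
    [Preadditive C] [Linear k C] {A B : C} [FiniteDimensional k (B ⟶ B)] {α β : A ⟶ B}
    (hα : ∃ a : B ⟶ B, β = α ≫ a) (hβ : ∃ b : B ⟶ B, α = β ≫ b) :
    ∃ u : B ≅ B, α ≫ u.hom = β := by
  obtain ⟨a, ha⟩ := hα
  obtain ⟨b, hb⟩ := hβ
  have : FiniteDimensional k (End B) := inferInstanceAs (FiniteDimensional k (B ⟶ B))
  have h₁ := finite_setOf_not_isUnit_one_add_smul k (End.of (a - 𝟙 B))
  have h₂ := (finite_setOf_not_isUnit_one_add_smul k (End.of (b - 𝟙 B))).preimage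
    (f := fun t : k => 1 - t) (sub_right_injective.injOn)
  obtain ⟨t, ht⟩ := (h₁.union h₂).infinite_compl.nonempty
  simp only [Set.mem_compl_iff, Set.mem_union, not_or, Set.mem_preimage, Set.mem_ofPred_eq,
    not_not, isUnit_iff_isIso] at ht
  have hf : IsIso (𝟙 B + t • (a - 𝟙 B)) := ht.1
  have hg : IsIso (𝟙 B + (1 - t) • (b - 𝟙 B)) := ht.2
  have key : α ≫ (𝟙 B + t • (a - 𝟙 B)) = β ≫ (𝟙 B + (1 - t) • (b - 𝟙 B)) := by
    simp only [Preadditive.comp_add, Linear.comp_smul, Preadditive.comp_sub, comp_id, ← ha, ← hb]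
    module
  exact ⟨asIso (𝟙 B + t • (a - 𝟙 B)) ≪≫ (asIso (𝟙 B + (1 - t) • (b - 𝟙 B))).symm, by
    simp only [Iso.trans_hom, asIso_hom, Iso.symm_hom, asIso_inv, ← assoc, IsIso.comp_inv_eq, key]⟩

namespace Pretriangulated

variable {C : Type*} [Category* C] [Preadditive C] [HasZeroObject C] [HasShift C ℤ]
  [∀ n : ℤ, (shiftFunctor C n).Additive] [Pretriangulated C]

/-- If the middle object `X` of a distinguished triangle `A₀ ⟶ X ⟶ A₁ ⟶(α) A₀⟦1⟧` satisfies
`Hom(X, X⟦1⟧) = 0`, then, when `Hom(A₀, A₁) = 0` and `A₁` has only scalar endomorphisms, every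
morphism `A₁ ⟶ A₀⟦1⟧` factors through `α`. -/
lemma exists_eq_mor₃_comp {k : Type*} [Semiring k] [Linear k C] {T : Triangle C}
    (hT : T ∈ distTriang C) (h0 : ∀ φ : T.obj₁ ⟶ T.obj₃, φ = 0)
    (hX : ∀ φ : T.obj₂ ⟶ T.obj₂⟦(1 : ℤ)⟧, φ = 0)
    (hEnd : ∀ c : T.obj₃ ⟶ T.obj₃, ∃ r : k, r • 𝟙 T.obj₃ = c)
    (φ : T.obj₃ ⟶ T.obj₁⟦(1 : ℤ)⟧) :
    ∃ e : T.obj₁⟦(1 : ℤ)⟧ ⟶ T.obj₁⟦(1 : ℤ)⟧, φ = T.mor₃ ≫ e := by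
  obtain ⟨ψ, hψ⟩ := T.coyoneda_exact₁ hT (T.mor₂ ≫ φ) (hX _)
  obtain ⟨c, rfl⟩ := T.yoneda_exact₂ hT ψ (h0 _)
  obtain ⟨r, rfl⟩ := hEnd c
  obtain ⟨e, he⟩ := T.yoneda_exact₃ hT (φ - r • T.mor₃) (by simp [hψ])
  exact ⟨r • 𝟙 _ + e, by simp [← he]⟩

/-- Distinguished triangles with isomorphic third morphisms are isomorphic. -/
lemma nonempty_iso_of_iso₁₃ {T T' : Triangle C} (hT : T ∈ distTriang C) (hT' : T' ∈ distTriang C)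
    (e₁ : T.obj₁ ≅ T'.obj₁) (e₃ : T.obj₃ ≅ T'.obj₃)
    (comm : T.mor₃ ≫ e₁.hom⟦(1 : ℤ)⟧' = e₃.hom ≫ T'.mor₃) : Nonempty (T ≅ T') := by
  obtain ⟨b, hb₁, hb₂⟩ := complete_distinguished_triangle_morphism₂ T T' hT hT' e₁.hom e₃.hom comm
  let φ : T ⟶ T' := ⟨e₁.hom, b, e₃.hom, hb₁, hb₂, comm⟩
  have : IsIso b := isIso₂_of_isIso₁₃ φ hT hT' (inferInstanceAs (IsIso e₁.hom))
    (inferInstanceAs (IsIso e₃.hom))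
  exact ⟨Triangle.isoMk T T' e₁ (asIso b) e₃ hb₁ hb₂ comm⟩

end Pretriangulated

end CategoryTheory

/-- **Base case of uniqueness of extensions with given factors.**
In the homotopy category of cochain complexes of vector spaces over an infinite field `k`,
suppose `A₀ ⟶ X ⟶ A₁ ⟶(α) A₀⟦1⟧` and `A₀ ⟶ W ⟶ A₁ ⟶(β) A₀⟦1⟧` are distinguished
triangles with `Hom^0(A₀, A₁) = 0`, `Hom^1(X, X) = 0`, `Hom^1(W, W) = 0`, `End A₁`
one-dimensional, and `End (A₀⟦1⟧)` and `Hom (A₁, A₀⟦1⟧)` finite-dimensional.  Then the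
two triangles are isomorphic; in particular `X ≅ W`. -/
theorem two_step_filtration_unique (k : Type) [Field k] [Infinite k]
    (A₀ A₁ X W : HomotopyCategory (ModuleCat k) (ComplexShape.up ℤ))
    (f : A₀ ⟶ X) (g : X ⟶ A₁) (α : A₁ ⟶ A₀⟦(1 : ℤ)⟧)
    (f' : A₀ ⟶ W) (g' : W ⟶ A₁) (β : A₁ ⟶ A₀⟦(1 : ℤ)⟧)
    (hT : Triangle.mk f g α ∈
      distTriang (HomotopyCategory (ModuleCat k) (ComplexShape.up ℤ)))
    (hT' : Triangle.mk f' g' β ∈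
      distTriang (HomotopyCategory (ModuleCat k) (ComplexShape.up ℤ)))
    (h0 : ∀ φ : A₀ ⟶ A₁⟦(0 : ℤ)⟧, φ = 0)
    (hX : ∀ φ : X ⟶ X⟦(1 : ℤ)⟧, φ = 0)
    (hW : ∀ φ : W ⟶ W⟦(1 : ℤ)⟧, φ = 0)
    [FiniteDimensional k (A₁ ⟶ A₁)]
    (hEndA₁ : Module.finrank k (A₁ ⟶ A₁) = 1)
    [FiniteDimensional k (A₀⟦(1 : ℤ)⟧ ⟶ A₀⟦(1 : ℤ)⟧)]
    [FiniteDimensional k (A₁ ⟶ A₀⟦(1 : ℤ)⟧)] :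
    Nonempty (Triangle.mk f g α ≅ Triangle.mk f' g' β) ∧ Nonempty (X ≅ W) := by
  have h0' (φ : A₀ ⟶ A₁) : φ = 0 := by
    rw [← cancel_mono ((shiftFunctorZero _ ℤ).inv.app A₁), Limits.zero_comp]
    exact h0 _
  have hA₁ : 𝟙 A₁ ≠ 0 := fun h => by
    have : Subsingleton (A₁ ⟶ A₁) := ⟨fun x y => by
      rw [← Category.comp_id x, ← Category.comp_id y, h, Limits.comp_zero, Limits.comp_zero]⟩
    simp [Module.finrank_zero_of_subsingleton] at hEndA₁
  have hEnd := (finrank_eq_one_iff_of_nonzero' (𝟙 A₁) hA₁).1 hEndA₁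
  obtain ⟨u, hu⟩ := exists_iso_comp_eq (k := k) (α := α) (β := β)
    (exists_eq_mor₃_comp hT h0' hX hEnd β) (exists_eq_mor₃_comp hT' h0' hW hEnd α)
  obtain ⟨e⟩ := nonempty_iso_of_iso₁₃ hT hT' ((shiftFunctor _ (1 : ℤ)).preimageIso u) (Iso.refl A₁)
    ((congrArg (α ≫ ·) (Functor.map_preimage _ u.hom)).trans
      (hu.trans (Category.id_comp β).symm))
  exact ⟨⟨e⟩, ⟨Triangle.π₂.mapIso e⟩⟩
end

section
/- (Iterated Mukai vanishing along a filtration.) Work in K = the homotopy category of cochain complexes of k-vector spaces, i.e. HomotopyCategory (ModuleCat k) (ComplexShape.up ℤ), which is a k-linear pretriangulated category; for objects A, B and n : ℤ write Hom^n(A,B) for the k-module of morphisms A ⟶ B⟦n⟧. Let X₀ = 0, X₁, …, X_n be objects of K with morphisms X_{i−1} ⟶ X_i, objects A₁, …, A_n, and distinguished triangles X_{i−1} ⟶ X_i ⟶ A_i ⟶ X_{i−1}⟦1⟧ for i = 1, …, n; set X = X_n. Assume for every i: Hom^0(X_{i−1}, A_i) = 0 and Hom^2(A_i, X_{i−1})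 = 0, and that the k-modules Hom^1(X_i, X_i) and Hom^1(A_i, A_i) are finite-dimensional. If Hom^1(X, X) = 0, then Hom^1(X_i, X_i) = 0 and Hom^1(A_i, A_i) = 0 for every i = 1, …, n. -/
open CategoryTheory Pretriangulated Limits

namespace CategoryTheory.Pretriangulated

variable {C : Type*} [Category* C] [Preadditive C] [HasZeroObject C] [HasShift C ℤ]
  [∀ n : ℤ, (shiftFunctor C n).Additive] [Pretriangulated C]

/-- Mukai vanishing for the first vertex of a distinguished triangle. -/
lemma hom_shift_one_obj₁_eq_zero {T : Triangle C} (hT : T ∈ distTriang C)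
    (h0 : ∀ φ : T.obj₁ ⟶ T.obj₃, φ = 0)
    (h2 : ∀ φ : T.obj₃ ⟶ T.obj₁⟦(1 : ℤ)⟧⟦(1 : ℤ)⟧, φ = 0)
    (hvanish : ∀ φ : T.obj₂ ⟶ T.obj₂⟦(1 : ℤ)⟧, φ = 0)
    (φ : T.obj₁ ⟶ T.obj₁⟦(1 : ℤ)⟧) : φ = 0 := by
  obtain ⟨ψ, hψ⟩ := T.rotate.yoneda_exact₃ (rot_of_distTriang T hT) (φ⟦(1 : ℤ)⟧') (h2 _)
  obtain ⟨ψ : T.obj₂ ⟶ T.obj₁⟦(1 : ℤ)⟧, rfl⟩ := (shiftFunctor C (1 : ℤ)).map_surjective ψ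
  obtain ⟨χ, rfl⟩ := T.coyoneda_exact₁ hT ψ (hvanish _)
  apply (shiftFunctor C (1 : ℤ)).map_injective
  replace hψ : φ⟦(1 : ℤ)⟧' = (-T.mor₁⟦(1 : ℤ)⟧') ≫ (χ ≫ T.mor₃)⟦(1 : ℤ)⟧' := hψ
  rw [hψ, Preadditive.neg_comp, ← Functor.map_comp, ← Category.assoc, h0 (T.mor₁ ≫ χ)]
  simp

/-- Mukai vanishing for the third vertex of a distinguished triangle. -/
lemma hom_shift_one_obj₃_eq_zero {T : Triangle C} (hT : T ∈ distTriang C)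
    (h0 : ∀ φ : T.obj₁ ⟶ T.obj₃, φ = 0)
    (h2 : ∀ φ : T.obj₃ ⟶ T.obj₁⟦(1 : ℤ)⟧⟦(1 : ℤ)⟧, φ = 0)
    (hvanish : ∀ φ : T.obj₂ ⟶ T.obj₂⟦(1 : ℤ)⟧, φ = 0)
    (φ : T.obj₃ ⟶ T.obj₃⟦(1 : ℤ)⟧) : φ = 0 := by
  obtain ⟨ψ, rfl⟩ := T.rotate.rotate.rotate.coyoneda_exact₃
    (rot_of_distTriang _ (rot_of_distTriang _ (rot_of_distTriang T hT))) φ (h2 _)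
  obtain ⟨χ, rfl⟩ := T.yoneda_exact₃ hT ψ (hvanish _)
  obtain ⟨χ : T.obj₁ ⟶ T.obj₂, rfl⟩ := (shiftFunctor C (1 : ℤ)).map_surjective χ
  change (T.mor₃ ≫ χ⟦(1 : ℤ)⟧') ≫ (-T.mor₂⟦(1 : ℤ)⟧') = 0
  rw [Category.assoc, Preadditive.comp_neg, ← Functor.map_comp, h0 (χ ≫ T.mor₂)]
  simp

end CategoryTheory.Pretriangulated

/-- **Iterated Mukai vanishing along a filtration.**
In the homotopy category of cochain complexes of `k`-vector spaces, let
`0 = X₀ ⟶ X₁ ⟶ ⋯ ⟶ Xₙ = X` be a filtration with distinguished triangles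
`X_{i-1} ⟶ X_i ⟶ A_i ⟶ X_{i-1}⟦1⟧` (here indexed by `i < n` as
`X i ⟶ X (i+1) ⟶ A (i+1) ⟶ (X i)⟦1⟧`).  Assume `Hom^0(X_{i-1}, A_i) = 0`,
`Hom^2(A_i, X_{i-1}) = 0`, and that `Hom^1(X_i, X_i)` and `Hom^1(A_i, A_i)` are
finite-dimensional.  If `Hom^1(X, X) = 0`, then `Hom^1(X_i, X_i) = 0` for all `i ≤ n`
and `Hom^1(A_i, A_i) = 0` for all `1 ≤ i ≤ n`. -/
theorem iterated_mukai_vanishing (k : Type) [Field k] (n : ℕ)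
    (X : ℕ → HomotopyCategory (ModuleCat k) (ComplexShape.up ℤ))
    (A : ℕ → HomotopyCategory (ModuleCat k) (ComplexShape.up ℤ))
    (hX0 : IsZero (X 0))
    (f : ∀ i, X i ⟶ X (i + 1))
    (g : ∀ i, X (i + 1) ⟶ A (i + 1))
    (h : ∀ i, A (i + 1) ⟶ (X i)⟦(1 : ℤ)⟧)
    (hT : ∀ i < n, Triangle.mk (f i) (g i) (h i) ∈
      distTriang (HomotopyCategory (ModuleCat k) (ComplexShape.up ℤ)))
    (h0 : ∀ i < n, ∀ φ : X i ⟶ (A (i + 1))⟦(0 : ℤ)⟧, φ = 0)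
    (h2 : ∀ i < n, ∀ φ : A (i + 1) ⟶ (X i)⟦(2 : ℤ)⟧, φ = 0)
    (hfdX : ∀ i ≤ n, FiniteDimensional k (X i ⟶ (X i)⟦(1 : ℤ)⟧))
    (hfdA : ∀ i, 1 ≤ i → i ≤ n → FiniteDimensional k (A i ⟶ (A i)⟦(1 : ℤ)⟧))
    (hvanish : ∀ φ : X n ⟶ (X n)⟦(1 : ℤ)⟧, φ = 0) :
    (∀ i ≤ n, ∀ φ : X i ⟶ (X i)⟦(1 : ℤ)⟧, φ = 0) ∧
      (∀ i, 1 ≤ i → i ≤ n → ∀ φ : A i ⟶ (A i)⟦(1 : ℤ)⟧, φ = 0) := by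
  have h0' : ∀ i < n, ∀ φ : X i ⟶ A (i + 1), φ = 0 := fun i hi φ => by
    rw [← cancel_mono ((shiftFunctorZero _ ℤ).inv.app (A (i + 1))), zero_comp]
    exact h0 i hi _
  have h2' : ∀ i < n, ∀ φ : A (i + 1) ⟶ (X i)⟦(1 : ℤ)⟧⟦(1 : ℤ)⟧, φ = 0 := fun i hi φ => by
    rw [← cancel_mono ((shiftFunctorAdd' _ (1 : ℤ) 1 2 (by norm_num)).inv.app (X i)), zero_comp]
    exact h2 i hi _
  have hX : ∀ i ≤ n, ∀ φ : X i ⟶ (X i)⟦(1 : ℤ)⟧, φ = 0 := fun i hi =>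
    Nat.decreasingInduction
      (motive := fun i _ => ∀ φ : X i ⟶ (X i)⟦(1 : ℤ)⟧, φ = 0)
      (fun i hi ih => hom_shift_one_obj₁_eq_zero (hT i hi) (h0' i hi) (h2' i hi) ih) hvanish hi
  refine ⟨hX, fun i hi hin => ?_⟩
  obtain ⟨i, rfl⟩ := Nat.exists_eq_add_of_le' hi
  exact hom_shift_one_obj₃_eq_zero (hT i hin) (h0' i hin) (h2' i hin) (hX (i + 1) hin)
end

section
/- (An object is determined by the ordered list of its filtration factors.) Let k be an infinite field and work in K = the homotopy category of cochain complexes of k-vector spaces, i.e. HomotopyCategory (ModuleCat k) (ComplexShape.up ℤ), which is a k-linear pretriangulated category; for objects A, B and n : ℤ write Hom^n(A,B) for the k-module of morphisms A ⟶ B⟦n⟧. Let A₁, …, A_n be objects of K, and let X₀ = 0, X₁, …, X_n = X and W₀ = 0, W₁, …, W_n = W be two chains of objects equipped with distinguished triangles X_{i−1} ⟶ X_i ⟶ A_i ⟶ X_{i−1}⟦1⟧ and W_{i−1} ⟶ W_i ⟶ A_i ⟶ W_{i−1}⟦1⟧ for i = 1, …, n (the same ordered factors A_i in both). Assume for every i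 = 1, …, n: Hom^0(X_{i−1}, A_i) = 0 and Hom^0(W_{i−1}, A_i) = 0; Hom^1(X_i, X_i) = 0 and Hom^1(W_i, W_i) = 0; End(A_i) is one-dimensional over k; and the k-modules End(X_{i−1}) and Hom(A_i, X_{i−1}⟦1⟧) are finite-dimensional. Then X ≅ W. -/
open CategoryTheory Pretriangulated Limits

namespace LinearMap

variable {k V W : Type*} [Field k] [AddCommGroup V] [AddCommGroup W] [Module k V] [Module k W]

lemma exists_comp_comp_eq_self (f : V →ₗ[k] W) : ∃ g : W →ₗ[k] V, f ∘ₗ g ∘ₗ f = f := by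
  obtain ⟨s, hs⟩ := f.rangeRestrict.exists_rightInverse_of_surjective f.range_rangeRestrict
  obtain ⟨g, hg⟩ := s.exists_extend
  refine ⟨g, LinearMap.ext fun x ↦ ?_⟩
  have h₁ : g (f x) = s (f.rangeRestrict x) := LinearMap.congr_fun hg (f.rangeRestrict x)
  have h₂ := congrArg Subtype.val (LinearMap.congr_fun hs (f.rangeRestrict x))
  simpa [h₁] using h₂

end LinearMap

namespace CochainComplex

universe v u

variable {k : Type u} [Field k] {K L : CochainComplex (ModuleCat.{v} k) ℤ}

lemma exists_d_comp_comp_d_eq (K : CochainComplex (ModuleCat.{v} k) ℤ) :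
    ∃ σ : ∀ i j, K.X j ⟶ K.X i, (∀ i j, K.d i j ≫ σ i j ≫ K.d i j = K.d i j) ∧
      ∀ i j, ¬ (ComplexShape.up ℤ).Rel i j → σ i j = 0 := by
  have h (i j) : ∃ s : K.X j ⟶ K.X i, K.d i j ≫ s ≫ K.d i j = K.d i j ∧
      (¬ (ComplexShape.up ℤ).Rel i j → s = 0) := by
    by_cases hij : (ComplexShape.up ℤ).Rel i j
    · obtain ⟨g, hg⟩ := (K.d i j).hom.exists_comp_comp_eq_self
      exact ⟨ModuleCat.ofHom g, ModuleCat.hom_ext hg, fun h ↦ (h hij).elim⟩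
    · exact ⟨0, by simp [K.shape _ _ hij], fun _ ↦ rfl⟩
  choose σ hσ hσ' using h
  exact ⟨σ, hσ, hσ'⟩

lemma nonempty_homotopy_zero_of_cycles_to_zero (f : K ⟶ L)
    (hf : ∀ i (z : K.X i), K.d i (i + 1) z = 0 → f.f i z = 0) : Nonempty (Homotopy f 0) := by
  obtain ⟨σ, hσ, hσ'⟩ := exists_d_comp_comp_d_eq K
  suffices f = Homotopy.nullHomotopicMap (fun i j ↦ σ j i ≫ f.f j) by
    rw [this]
    exact ⟨Homotopy.nullHomotopy _ fun i j hij ↦ by rw [hσ' _ _ hij, zero_comp]⟩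
  ext i x
  have hσd : K.d i (i + 1) (σ i (i + 1) (K.d i (i + 1) x)) = K.d i (i + 1) x :=
    ConcreteCategory.congr_hom (hσ i (i + 1)) x
  have h₁ : f.f i (σ i (i + 1) (K.d i (i + 1) x)) = f.f i x := by
    have := hf i (σ i (i + 1) (K.d i (i + 1) x) - x) (by rw [map_sub, hσd, sub_self])
    rwa [map_sub, sub_eq_zero] at this
  have h₂ : f.f i (K.d (i - 1) i (σ (i - 1) i x)) = 0 :=
    hf i _ (ConcreteCategory.congr_hom (K.d_comp_d (i - 1) i (i + 1)) _)
  rw [Homotopy.nullHomotopicMap_f (k₂ := i - 1) (k₁ := i) (k₀ := i + 1) (by simp) (by simp)]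
  simpa [h₁] using h₂

lemma nonempty_homotopy_zero_of_cycles_to_boundaries (f : K ⟶ L)
    (hf : ∀ i (z : K.X i), K.d i (i + 1) z = 0 → ∃ y, L.d (i - 1) i y = f.f i z) :
    Nonempty (Homotopy f 0) := by
  obtain ⟨τ, hτ, hτ'⟩ := exists_d_comp_comp_d_eq L
  let g := Homotopy.nullHomotopicMap (fun i j ↦ f.f i ≫ τ j i)
  have hg : Homotopy g 0 :=
    Homotopy.nullHomotopy _ fun i j hij ↦ by rw [hτ' _ _ hij, comp_zero]
  obtain ⟨h⟩ := nonempty_homotopy_zero_of_cycles_to_zero (f - g) fun i z hz ↦ by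
    obtain ⟨y, hy⟩ := hf i z hz
    have hy' : L.d (i - 1) i (τ (i - 1) i (L.d (i - 1) i y)) = L.d (i - 1) i y :=
      ConcreteCategory.congr_hom (hτ (i - 1) i) y
    have hgz : g.f i z = f.f i z := by
      dsimp only [g]
      rw [Homotopy.nullHomotopicMap_f (k₂ := i - 1) (k₁ := i) (k₀ := i + 1) (by simp) (by simp)]
      simp [hz, ← hy, hy']
    simp [hgz]
  exact ⟨(Homotopy.equivSubZero.symm h).trans hg⟩

/-- A morphism that is not null-homotopic is nonzero on the class of some cycle `z`; projecting
onto a line detecting the image of `z` and mapping back to `z` produces `g`. -/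
lemma exists_comp_not_nullHomotopic (f : K ⟶ L) (hf : IsEmpty (Homotopy f 0)) :
    ∃ g : L ⟶ K, IsEmpty (Homotopy (f ≫ g) 0) := by
  have : ∃ i, ∃ z : K.X i, K.d i (i + 1) z = 0 ∧ ∀ y, L.d (i - 1) i y ≠ f.f i z := by
    by_contra! h
    exact (nonempty_homotopy_zero_of_cycles_to_boundaries f h).elim hf.false
  obtain ⟨i, z, hz, hfz⟩ := this
  obtain ⟨l, hl, hl'⟩ := Submodule.exists_le_ker_of_notMem
    (p := (L.d (i - 1) i).hom.range) (v := f.f i z) (by rintro ⟨y, hy⟩; exact hfz y hy)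
  let V : Submodule k (K.X i) := LinearMap.ker (K.d i (i + 1)).hom
  let φ : L.X i ⟶ ModuleCat.of k V := ModuleCat.ofHom (l.smulRight ⟨z, hz⟩)
  let ψ : ModuleCat.of k V ⟶ K.X i := ModuleCat.ofHom V.subtype
  have hφ (j : ℤ) (hj : (ComplexShape.up ℤ).Rel j i) : L.d j i ≫ φ = 0 := by
    obtain rfl : j = i - 1 := by simp at hj; lia
    ext y
    have hy : l (L.d (i - 1) i y) = 0 := hl' ⟨y, rfl⟩
    simp [φ, hy]
  have hψ (j : ℤ) (hj : (ComplexShape.up ℤ).Rel i j) : ψ ≫ K.d i j = 0 := by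
    obtain rfl : i + 1 = j := hj
    ext y
    exact y.2
  let g := HomologicalComplex.mkHomToSingle φ hφ ≫ HomologicalComplex.mkHomFromSingle ψ hψ
  have hg : g.f i = φ ≫ ψ := by simp [g]
  refine ⟨g, ⟨fun H ↦ ?_⟩⟩
  have h₁ : g.f i (f.f i z) = l (f.f i z) • z := by rw [hg]; rfl
  have h₂ : K.d (i - 1) i (H.hom i (i - 1) z) = l (f.f i z) • z := by
    have h := ConcreteCategory.congr_hom (H.comm i) z
    rw [dNext_eq (i' := i + 1) _ (by simp), prevD_eq (j' := i - 1) _ (by simp)] at h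
    simpa [hz, h₁] using h.symm
  refine hfz ((l (f.f i z))⁻¹ • f.f (i - 1) (H.hom i (i - 1) z)) ?_
  rw [map_smul, ← ConcreteCategory.comp_apply, f.comm, ConcreteCategory.comp_apply, h₂, map_smul,
    inv_smul_smul₀ hl]

end CochainComplex

namespace HomotopyCategory

universe v u

variable {k : Type u} [Field k]

lemma exists_comp_ne_zero {A Y : HomotopyCategory (ModuleCat.{v} k) (ComplexShape.up ℤ)}
    (h : A ⟶ Y) (hh : h ≠ 0) : ∃ r : Y ⟶ A, h ≫ r ≠ 0 := by
  obtain ⟨K, rfl⟩ := quotient_obj_surjective A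
  obtain ⟨L, rfl⟩ := quotient_obj_surjective Y
  obtain ⟨f, rfl⟩ := (quotient _ _).map_surjective h
  rw [Ne, quotient_map_eq_zero_iff, not_nonempty_iff] at hh
  obtain ⟨g, hg⟩ := CochainComplex.exists_comp_not_nullHomotopic f hh
  refine ⟨(quotient _ _).map g, ?_⟩
  rwa [← Functor.map_comp, Ne, quotient_map_eq_zero_iff, not_nonempty_iff]

end HomotopyCategory

namespace CategoryTheory

lemma exists_iso_comp_eq_of_retractions {k C : Type*} [Field k] [Category* C] [Preadditive C]
    [Linear k C] {A Y : C} (hA : ∀ φ : A ⟶ A, ∃ c : k, c • 𝟙 A = φ) {h h' : A ⟶ Y}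
    {r r' : Y ⟶ A} (hr : h ≫ r ≠ 0) (hr' : h' ≫ r' ≠ 0) :
    ∃ e : Y ≅ Y, h ≫ e.hom = h' := by
  obtain ⟨p, hp, hp'⟩ : ∃ p : Y ⟶ A, h ≫ p ≠ 0 ∧ h' ≫ p ≠ 0 := by
    by_cases h₁ : h' ≫ r = 0
    · by_cases h₂ : h ≫ r' = 0
      · exact ⟨r + r', by simpa [h₂] using hr, by simpa [h₁] using hr'⟩
      · exact ⟨r', h₂, hr'⟩
    · exact ⟨r, hr, h₁⟩
  obtain ⟨a, ha⟩ := hA (h ≫ p)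
  obtain ⟨b, hb⟩ := hA (h' ≫ p)
  have ha₀ : a ≠ 0 := by rintro rfl; simp [← ha] at hp
  have hb₀ : b ≠ 0 := by rintro rfl; simp [← hb] at hp'
  have hu : (p ≫ (h' - h)) ≫ p ≫ (h' - h) = (b - a) • (p ≫ (h' - h)) := by
    have : (h' - h) ≫ p = (b - a) • 𝟙 A := by rw [Preadditive.sub_comp, ← ha, ← hb, sub_smul]
    rw [Category.assoc, reassoc_of% this, Linear.smul_comp, Category.id_comp, Linear.comp_smul]
  have hhp : h ≫ p ≫ (h' - h) = a • (h' - h) := by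
    rw [← Category.assoc, ← ha, Linear.smul_comp, Category.id_comp]
  generalize p ≫ (h' - h) = u at hu hhp
  have hcoeff : a⁻¹ - b⁻¹ - a⁻¹ * b⁻¹ * (b - a) = 0 := by field_simp; ring
  have huu : a⁻¹ • u - b⁻¹ • u - (a⁻¹ * b⁻¹) • (b - a) • u = 0 := by
    rw [smul_smul, ← sub_smul, ← sub_smul, hcoeff, zero_smul]
  refine ⟨⟨𝟙 Y + a⁻¹ • u, 𝟙 Y - b⁻¹ • u, ?_, ?_⟩, ?_⟩
  · simp only [Preadditive.add_comp, Preadditive.comp_sub, Linear.smul_comp, Linear.comp_smul,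
      Category.id_comp, Category.comp_id, hu, smul_smul] at huu ⊢
    rw [← sub_eq_zero, ← huu]
    module
  · simp only [Preadditive.sub_comp, Preadditive.comp_add, Linear.smul_comp, Linear.comp_smul,
      Category.id_comp, Category.comp_id, hu, smul_smul] at huu ⊢
    rw [← sub_eq_zero, ← huu]
    module
  · rw [Preadditive.comp_add, Category.comp_id, Linear.comp_smul, hhp, inv_smul_smul₀ ha₀,
      add_sub_cancel]

variable {C : Type*} [Category* C] [Preadditive C] [HasZeroObject C] [HasShift C ℤ]
  [∀ n : ℤ, (shiftFunctor C n).Additive] [Pretriangulated C]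

lemma Pretriangulated.eq_zero_of_mor₃_eq_zero {X Y A : C} {f : X ⟶ Y} {g : Y ⟶ A}
    {h : A ⟶ X⟦(1 : ℤ)⟧} (hT : Triangle.mk f g h ∈ distTriang C)
    (hY : ∀ φ : Y ⟶ Y⟦(1 : ℤ)⟧, φ = 0) (hh : h = 0) (φ : A ⟶ X⟦(1 : ℤ)⟧) : φ = 0 := by
  have : Epi g := (Triangle.mor₃_eq_zero_iff_epi₂ _ hT).1 hh
  have h₁ : φ ≫ f⟦(1 : ℤ)⟧' = 0 := by
    rw [← cancel_epi g, comp_zero]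
    exact hY _
  obtain ⟨ψ, hψ⟩ := Triangle.coyoneda_exact₁ _ hT φ h₁
  rw [hψ]
  subst hh
  exact comp_zero

lemma Pretriangulated.nonempty_iso_obj₂ {X X' W W' A : C} {f : X ⟶ X'} {g : X' ⟶ A}
    {h : A ⟶ X⟦(1 : ℤ)⟧} {f' : W ⟶ W'} {g' : W' ⟶ A} {h' : A ⟶ W⟦(1 : ℤ)⟧}
    (hT : Triangle.mk f g h ∈ distTriang C) (hT' : Triangle.mk f' g' h' ∈ distTriang C)
    (e : X⟦(1 : ℤ)⟧ ≅ W⟦(1 : ℤ)⟧) (he : h ≫ e.hom = h') : Nonempty (X' ≅ W') := by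
  let i := isoTriangleOfIso₁₂ _ _ (rot_of_distTriang _ (rot_of_distTriang _ hT))
    (rot_of_distTriang _ (rot_of_distTriang _ hT')) (Iso.refl A) e
    (he.trans (Category.id_comp h').symm)
  exact ⟨(shiftFunctor C (1 : ℤ)).preimageIso (Triangle.π₃.mapIso i)⟩

end CategoryTheory

/-- **An object is determined by the ordered list of its filtration factors.**
In the homotopy category of cochain complexes of vector spaces over an infinite field
`k`, let `0 = X₀ ⟶ X₁ ⟶ ⋯ ⟶ Xₙ = X` and `0 = W₀ ⟶ W₁ ⟶ ⋯ ⟶ Wₙ = W` be two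
filtrations with the *same* ordered factors `A₁, …, Aₙ`, via distinguished triangles
`X_{i-1} ⟶ X_i ⟶ A_i ⟶ X_{i-1}⟦1⟧` (indexed here by `i < n` as
`X i ⟶ X (i+1) ⟶ A (i+1) ⟶ (X i)⟦1⟧`), and similarly for `W`.  Assume for each
`i = 1, …, n`: `Hom^0(X_{i-1}, A_i) = 0` and `Hom^0(W_{i-1}, A_i) = 0`;
`Hom^1(X_i, X_i) = 0` and `Hom^1(W_i, W_i) = 0`; `End (A_i)` is one-dimensional;
and `End (X_{i-1})` and `Hom (A_i, X_{i-1}⟦1⟧)` are finite-dimensional.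
Then `X ≅ W`. -/
theorem object_determined_by_hn_filtration (k : Type) [Field k] [Infinite k] (n : ℕ)
    (X W : ℕ → HomotopyCategory (ModuleCat k) (ComplexShape.up ℤ))
    (A : ℕ → HomotopyCategory (ModuleCat k) (ComplexShape.up ℤ))
    (hX0 : IsZero (X 0)) (hW0 : IsZero (W 0))
    (fX : ∀ i, X i ⟶ X (i + 1))
    (gX : ∀ i, X (i + 1) ⟶ A (i + 1))
    (hX : ∀ i, A (i + 1) ⟶ (X i)⟦(1 : ℤ)⟧)
    (fW : ∀ i, W i ⟶ W (i + 1))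
    (gW : ∀ i, W (i + 1) ⟶ A (i + 1))
    (hW : ∀ i, A (i + 1) ⟶ (W i)⟦(1 : ℤ)⟧)
    (hTX : ∀ i < n, Triangle.mk (fX i) (gX i) (hX i) ∈
      distTriang (HomotopyCategory (ModuleCat k) (ComplexShape.up ℤ)))
    (hTW : ∀ i < n, Triangle.mk (fW i) (gW i) (hW i) ∈
      distTriang (HomotopyCategory (ModuleCat k) (ComplexShape.up ℤ)))
    (h0X : ∀ i < n, ∀ φ : X i ⟶ (A (i + 1))⟦(0 : ℤ)⟧, φ = 0)
    (h0W : ∀ i < n, ∀ φ : W i ⟶ (A (i + 1))⟦(0 : ℤ)⟧, φ = 0)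
    (h1X : ∀ i, 1 ≤ i → i ≤ n → ∀ φ : X i ⟶ (X i)⟦(1 : ℤ)⟧, φ = 0)
    (h1W : ∀ i, 1 ≤ i → i ≤ n → ∀ φ : W i ⟶ (W i)⟦(1 : ℤ)⟧, φ = 0)
    (hfdEndA : ∀ i, 1 ≤ i → i ≤ n → FiniteDimensional k (A i ⟶ A i))
    (hEndA : ∀ i, 1 ≤ i → i ≤ n → Module.finrank k (A i ⟶ A i) = 1)
    (hfdEndX : ∀ i < n, FiniteDimensional k (X i ⟶ X i))
    (hfdHom : ∀ i < n, FiniteDimensional k (A (i + 1) ⟶ (X i)⟦(1 : ℤ)⟧)) :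
    Nonempty (X n ≅ W n) := by
  induction n with
  | zero => exact ⟨hX0.iso hW0⟩
  | succ n ih =>
    obtain ⟨e⟩ := ih (fun i hi ↦ hTX i (by lia)) (fun i hi ↦ hTW i (by lia))
      (fun i hi ↦ h0X i (by lia)) (fun i hi ↦ h0W i (by lia))
      (fun i hi hi' ↦ h1X i hi (by lia)) (fun i hi hi' ↦ h1W i hi (by lia))
      (fun i hi hi' ↦ hfdEndA i hi (by lia)) (fun i hi hi' ↦ hEndA i hi (by lia))
      (fun i hi ↦ hfdEndX i (by lia)) (fun i hi ↦ hfdHom i (by lia))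
    let e₁ := (shiftFunctor _ (1 : ℤ)).mapIso e
    have hTX' := hTX n (by lia)
    have hTW' := hTW n (by lia)
    by_cases hX₀ : hX n = 0
    · have hall := eq_zero_of_mor₃_eq_zero hTX' (h1X _ (by lia) le_rfl) hX₀
      refine nonempty_iso_obj₂ hTX' hTW' e₁ ?_
      rw [← cancel_mono e₁.inv, hall (hW n ≫ e₁.inv), hX₀, zero_comp, zero_comp]
    by_cases hW₀ : hW n = 0
    · have hall := eq_zero_of_mor₃_eq_zero hTW' (h1W _ (by lia) le_rfl) hW₀
      exact nonempty_iso_obj₂ hTX' hTW' e₁ ((hall _).trans hW₀.symm)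
    have hX₁ : hX n ≫ e₁.hom ≠ 0 := by simpa using hX₀
    obtain ⟨r, hr⟩ := HomotopyCategory.exists_comp_ne_zero _ hX₁
    obtain ⟨r', hr'⟩ := HomotopyCategory.exists_comp_ne_zero _ hW₀
    have hid : 𝟙 (A (n + 1)) ≠ 0 := fun h ↦ hW₀ (by rw [← Category.id_comp (hW n), h, zero_comp])
    obtain ⟨e₂, he₂⟩ := exists_iso_comp_eq_of_retractions
      ((finrank_eq_one_iff_of_nonzero' _ hid).1 (hEndA (n + 1) (by lia) le_rfl)) hr hr'
    exact nonempty_iso_obj₂ hTX' hTW' (e₁ ≪≫ e₂) (by simpa using he₂)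
end

section
/- (Upper bound on the number of edges of a non-crossing pointed set of segments.) Let n ≥ 1 and let a : Fin (n+1) → ℝ² (the Euclidean plane) be an injective family of points. Let T be a finite set of unordered pairs {i, j} of distinct indices in Fin (n+1), thought of as the straight-line segments [a i, a j]. Assume: (interiors avoid marked points) for every {i, j} ∈ T and every index k with k ≠ i and k ≠ j, the point a k does not lie on the segment [a i, a j]; (non-crossing) for any two distinct pairs {i, j}, {k, l} ∈ T, every point of the intersection [a i, a j] ∩ [a k, a l] is an endpoint a m for some index m belonging to both pairs; (pointed) for every index i there exists a linear functional φ : ℝ² → ℝ such that φ(a j − a i) > 0 for every j with {i, j} ∈ T. Then the cardinality of T is at most 2n − 1. -/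
open Filter Topology

/-- The determinant of the vectors from `p` to the `i`-th and to the `j`-th of the points
`(x i, y i)`. -/
def crossDet {ι : Type*} (x y : ι → ℝ) (i j : ι) (p : ℝ × ℝ) : ℝ :=
  (x i - p.1) * (y j - p.2) - (x j - p.1) * (y i - p.2)

open Classical in
/-- The indicator of the `i`-th point being strictly to the right of `p`. -/
noncomputable def rightOf {ι : Type*} (x : ι → ℝ) (p : ℝ × ℝ) (i : ι) : ℝ :=
  if p.1 < x i then 1 else 0

/-- The contribution of the pair `(i, j)` to the Maxwell–Cremona lifting of the weights `W`. -/
noncomputable def liftTerm {ι : Type*} (x y : ι → ℝ) (W : ι → ι → ℝ) (i j : ι) (p : ℝ × ℝ) : ℝ :=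
  W i j * (|rightOf x p i - rightOf x p j| * |crossDet x y i j p|)

/-- The Maxwell–Cremona lifting of the weights `W`. -/
noncomputable def lifting {ι : Type*} [Fintype ι] (x y : ι → ℝ) (W : ι → ι → ℝ) (p : ℝ × ℝ) : ℝ :=
  ∑ i, ∑ j, liftTerm x y W i j p

/-- The real number `X` lies strictly between `x i` and `x j`. -/
def Separates {ι : Type*} (x : ι → ℝ) (i j : ι) (X : ℝ) : Prop :=
  x i < X ∧ X < x j ∨ x j < X ∧ X < x i

/-- `W` is an equilibrium stress on a framework with vertices `(x i, y i)`. -/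
structure IsStress {ι : Type*} [Fintype ι] (x y : ι → ℝ) (W : ι → ι → ℝ) : Prop where
  symm : ∀ i j, W i j = W j i
  sum_x : ∀ i, ∑ j, W i j * (x j - x i) = 0
  sum_y : ∀ i, ∑ j, W i j * (y j - y i) = 0

/-- `W` is supported on a non-crossing pointed framework, with distinct abscissae and no
vertical direction of pointedness. -/
structure IsPointedFramework {ι : Type*} (x y : ι → ℝ) (W : ι → ι → ℝ) : Prop where
  inj : Function.Injective x
  avoid : ∀ i j k, W i j ≠ 0 → Separates x i j (x k) → crossDet x y i j (x k, y k) ≠ 0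
  noncrossing : ∀ i j k l p, W i j ≠ 0 → W k l ≠ 0 → Separates x i j p.1 → Separates x k l p.1 →
    crossDet x y i j p = 0 → crossDet x y k l p = 0 → s(i, j) = s(k, l)
  pointed : ∀ k, ∃ d : ℝ × ℝ, d.1 ≠ 0 ∧
    ∀ j, W k j ≠ 0 → 0 < d.1 * (y j - y k) - d.2 * (x j - x k)

section Elementary

variable {ι : Type*} {x y : ι → ℝ} {W : ι → ι → ℝ}

theorem crossDet_swap (i j : ι) (p : ℝ × ℝ) : crossDet x y j i p = -crossDet x y i j p := by
  unfold crossDet; ring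

@[simp] theorem crossDet_self (i : ι) (p : ℝ × ℝ) : crossDet x y i i p = 0 := by
  unfold crossDet; ring

theorem continuous_crossDet (i j : ι) : Continuous (crossDet x y i j) := by
  unfold crossDet; fun_prop

theorem crossDet_add_smul (i j : ι) (p d : ℝ × ℝ) (t : ℝ) :
    crossDet x y i j (p + t • d) =
      crossDet x y i j p + t * (d.2 * (x j - x i) - d.1 * (y j - y i)) := by
  simp only [crossDet, Prod.fst_add, Prod.snd_add, Prod.smul_fst, Prod.smul_snd, smul_eq_mul]
  ring

theorem crossDet_sub_smul (i j : ι) (p d : ℝ × ℝ) (t : ℝ) :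
    crossDet x y i j (p - t • d) =
      crossDet x y i j p - t * (d.2 * (x j - x i) - d.1 * (y j - y i)) := by
  rw [sub_eq_add_neg p, ← neg_smul, crossDet_add_smul]; ring

theorem rightOf_eq_zero_or_one (p : ℝ × ℝ) (i : ι) : rightOf x p i = 0 ∨ rightOf x p i = 1 := by
  unfold rightOf; split_ifs <;> simp

theorem separates_of_rightOf_ne {p : ℝ × ℝ} {i j : ι} (hi : x i ≠ p.1) (hj : x j ≠ p.1)
    (h : rightOf x p i ≠ rightOf x p j) : Separates x i j p.1 := by
  unfold rightOf at h
  unfold Separates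
  rcases lt_or_gt_of_ne hi with hi | hi <;> rcases lt_or_gt_of_ne hj with hj | hj <;>
    simp_all [not_lt_of_gt]

theorem Separates.abs_rightOf {p : ℝ × ℝ} {i j : ι} (h : Separates x i j p.1) :
    |rightOf x p i - rightOf x p j| = 1 := by
  unfold rightOf
  rcases h with ⟨h, h'⟩ | ⟨h, h'⟩ <;> simp [h', not_lt_of_gt h]

theorem eventually_rightOf {p : ℝ × ℝ} {i : ι} (hi : x i ≠ p.1) :
    ∀ᶠ q in 𝓝 p, rightOf x q i = rightOf x p i := by
  rcases lt_or_gt_of_ne hi with hi | hi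
  · filter_upwards [continuous_fst.continuousAt.eventually_const_lt hi] with q hq
    simp [rightOf, not_lt_of_gt hi, not_lt_of_gt hq]
  · filter_upwards [continuous_fst.continuousAt.eventually_lt_const hi] with q hq
    simp [rightOf, hi, hq]

theorem liftTerm_swap (hW : ∀ i j, W i j = W j i) (i j : ι) (p : ℝ × ℝ) :
    liftTerm x y W j i p = liftTerm x y W i j p := by
  unfold liftTerm
  rw [hW j i, crossDet_swap i j, abs_neg, abs_sub_comm]

@[simp] theorem liftTerm_self (i : ι) (p : ℝ × ℝ) : liftTerm x y W i i p = 0 := by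
  simp [liftTerm]

/-- The second difference of `f` at `p` in direction `d` vanishes near `0`. -/
def LocallyBalanced (f : ℝ × ℝ → ℝ) (p d : ℝ × ℝ) : Prop :=
  ∀ᶠ t : ℝ in 𝓝 0, f (p + t • d) + f (p - t • d) = 2 * f p

theorem LocallyBalanced.add {f g : ℝ × ℝ → ℝ} {p d : ℝ × ℝ} (hf : LocallyBalanced f p d)
    (hg : LocallyBalanced g p d) : LocallyBalanced (fun q => f q + g q) p d := by
  filter_upwards [hf, hg] with t h1 h2
  linarith

theorem LocallyBalanced.sum {κ : Type*} {s : Finset κ} {f : κ → ℝ × ℝ → ℝ} {p d : ℝ × ℝ}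
    (hf : ∀ i ∈ s, LocallyBalanced (f i) p d) :
    LocallyBalanced (fun q => ∑ i ∈ s, f i q) p d := by
  filter_upwards [(Filter.eventually_all_finset s).2 hf] with t h
  rw [← Finset.sum_add_distrib, Finset.mul_sum]
  exact Finset.sum_congr rfl h

theorem tendsto_add_smul (p d : ℝ × ℝ) : Tendsto (fun t : ℝ => p + t • d) (𝓝 0) (𝓝 p) := by
  have : Continuous fun t : ℝ => p + t • d := by fun_prop
  simpa using this.tendsto 0

theorem tendsto_sub_smul (p d : ℝ × ℝ) : Tendsto (fun t : ℝ => p - t • d) (𝓝 0) (𝓝 p) := by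
  have : Continuous fun t : ℝ => p - t • d := by fun_prop
  simpa using this.tendsto 0

theorem LocallyBalanced.congr {f g : ℝ × ℝ → ℝ} {p d : ℝ × ℝ} (hg : LocallyBalanced g p d)
    (h : ∀ᶠ q in 𝓝 p, f q = g q) : LocallyBalanced f p d := by
  filter_upwards [hg, (tendsto_add_smul p d).eventually h, (tendsto_sub_smul p d).eventually h]
    with t h1 h2 h3
  rw [h2, h3, h1, h.self_of_nhds]

theorem LocallyBalanced.abs {f : ℝ × ℝ → ℝ} {p d : ℝ × ℝ} (hf : LocallyBalanced f p d)
    (hc : ContinuousAt f p) (h0 : f p ≠ 0) : LocallyBalanced (fun q => |f q|) p d := by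
  rcases lt_or_gt_of_ne h0 with h | h
  · refine LocallyBalanced.congr (g := fun q => -f q) ?_ ?_
    · filter_upwards [hf] with t ht
      linarith
    · filter_upwards [hc.eventually_lt_const h] with q hq using abs_of_neg hq
  · refine hf.congr ?_
    filter_upwards [hc.eventually_const_lt h] with q hq using abs_of_pos hq

theorem locallyBalanced_crossDet (i j : ι) (p d : ℝ × ℝ) :
    LocallyBalanced (crossDet x y i j) p d :=
  Eventually.of_forall fun t => by rw [crossDet_add_smul, crossDet_sub_smul]; ring

theorem LocallyBalanced.const_mul {f : ℝ × ℝ → ℝ} {p d : ℝ × ℝ} (hf : LocallyBalanced f p d)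
    (c : ℝ) : LocallyBalanced (fun q => c * f q) p d := by
  filter_upwards [hf] with t ht
  rw [← mul_add, ht]; ring

/-- Away from the vertical lines through its ends, a term is locally a multiple of `|crossDet|`. -/
theorem eventually_liftTerm {i j : ι} {p : ℝ × ℝ} (hi : x i ≠ p.1) (hj : x j ≠ p.1) :
    ∀ᶠ q in 𝓝 p, liftTerm x y W i j q =
      W i j * |rightOf x p i - rightOf x p j| * |crossDet x y i j q| := by
  filter_upwards [eventually_rightOf hi, eventually_rightOf hj] with q h1 h2
  rw [liftTerm, h1, h2, mul_assoc]

theorem continuousAt_liftTerm {i j : ι} {p : ℝ × ℝ} (hi : x i ≠ p.1) (hj : x j ≠ p.1) :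
    ContinuousAt (liftTerm x y W i j) p :=
  ContinuousAt.congr ((continuous_crossDet i j).abs.const_mul _).continuousAt
    ((eventually_liftTerm hi hj).mono fun _ h => h.symm)

theorem locallyBalanced_liftTerm {i j : ι} {p d : ℝ × ℝ} (hi : x i ≠ p.1) (hj : x j ≠ p.1)
    (h : W i j ≠ 0 → Separates x i j p.1 → crossDet x y i j p = 0 →
      d.2 * (x j - x i) - d.1 * (y j - y i) = 0) :
    LocallyBalanced (liftTerm x y W i j) p d := by
  refine LocallyBalanced.congr ?_ (eventually_liftTerm hi hj)
  by_cases hW : W i j = 0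
  · simp [hW, LocallyBalanced]
  by_cases hr : rightOf x p i = rightOf x p j
  · simp [hr, LocallyBalanced]
  refine LocallyBalanced.const_mul ?_ _
  by_cases hD : crossDet x y i j p = 0
  · refine Eventually.of_forall fun t => ?_
    simp [crossDet_add_smul, crossDet_sub_smul, h hW (separates_of_rightOf_ne hi hj hr) hD, hD]
  · exact (locallyBalanced_crossDet i j p d).abs (continuous_crossDet i j).continuousAt hD

end Elementary

section Stress

variable {ι : Type*} [Fintype ι] {x y : ι → ℝ} {W : ι → ι → ℝ}

theorem IsStress.neg (h : IsStress x y W) : IsStress x y fun i j => -W i j where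
  symm i j := by rw [h.symm]
  sum_x i := by simpa using h.sum_x i
  sum_y i := by simpa using h.sum_y i

theorem IsPointedFramework.neg {ι : Type*} {x y : ι → ℝ} {W : ι → ι → ℝ}
    (h : IsPointedFramework x y W) : IsPointedFramework x y fun i j => -W i j where
  inj := h.inj
  avoid i j k hW := h.avoid i j k (neg_ne_zero.1 hW)
  noncrossing i j k l p h1 h2 := h.noncrossing i j k l p (neg_ne_zero.1 h1) (neg_ne_zero.1 h2)
  pointed k := (h.pointed k).imp fun _ hd => ⟨hd.1, fun j hj => hd.2 j (neg_ne_zero.1 hj)⟩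

theorem lifting_neg (p : ℝ × ℝ) : lifting x y (fun i j => -W i j) p = -lifting x y W p := by
  simp [lifting, liftTerm]

theorem IsStress.sum_crossDet (h : IsStress x y W) (i : ι) (p : ℝ × ℝ) :
    ∑ j, W i j * crossDet x y i j p = 0 := by
  have : ∀ j, W i j * crossDet x y i j p =
      (x i - p.1) * (W i j * (y j - y i)) - (y i - p.2) * (W i j * (x j - x i)) := fun j => by
    unfold crossDet; ring
  simp_rw [this, Finset.sum_sub_distrib, ← Finset.mul_sum, h.sum_x, h.sum_y]
  simp

/-- Any additive function of the vertices gives a vanishing weighted sum. -/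
theorem IsStress.sum_crossDet_mul_sub (h : IsStress x y W) (s : ι → ℝ) (p : ℝ × ℝ) :
    ∑ i, ∑ j, W i j * (crossDet x y i j p * (s i - s j)) = 0 := by
  have h1 : ∑ i, ∑ j, W i j * (crossDet x y i j p * s i) = 0 := by
    refine Finset.sum_eq_zero fun i _ => ?_
    simp_rw [← mul_assoc, ← Finset.sum_mul, h.sum_crossDet, zero_mul]
  have h2 : ∑ i, ∑ j, W i j * (crossDet x y i j p * s j) = 0 := by
    rw [Finset.sum_comm, ← neg_eq_zero, ← h1, ← Finset.sum_neg_distrib]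
    refine Finset.sum_congr rfl fun i _ => ?_
    rw [← Finset.sum_neg_distrib]
    refine Finset.sum_congr rfl fun j _ => ?_
    rw [h.symm, crossDet_swap i j]; ring
  simp_rw [mul_sub, Finset.sum_sub_distrib, h1, h2, sub_zero]

theorem IsStress.lifting_eq_zero_of_sign (h : IsStress x y W) (p : ℝ × ℝ) (c : ℝ)
    (hc : ∀ i j, |rightOf x p i - rightOf x p j| * |crossDet x y i j p| =
      c * (crossDet x y i j p * (rightOf x p i - rightOf x p j))) :
    lifting x y W p = 0 := by
  simp_rw [lifting, liftTerm, hc, mul_left_comm _ c, ← Finset.mul_sum,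
    h.sum_crossDet_mul_sub, mul_zero]

/-- The lifting vanishes outside a box containing all the vertices. -/
theorem IsStress.lifting_eq_zero (h : IsStress x y W) {R : ℝ} (hx : ∀ i, |x i| ≤ R)
    (hy : ∀ i, |y i| ≤ R) {p : ℝ × ℝ} (hp : p ∉ Set.Icc (-R) R ×ˢ Set.Icc (-R) R) :
    lifting x y W p = 0 := by
  have hx' := fun i => abs_le.1 (hx i)
  have hy' := fun i => abs_le.1 (hy i)
  have key : p.1 < -R ∨ R < p.1 ∨ p.2 < -R ∨ R < p.2 := by
    by_contra! hh
    exact hp ⟨⟨hh.1, hh.2.1⟩, hh.2.2.1, hh.2.2.2⟩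
  rcases key with hX | hX | hY | hY
  · refine h.lifting_eq_zero_of_sign p 0 fun i j => ?_
    simp [rightOf, hX.trans_le (hx' i).1, hX.trans_le (hx' j).1]
  · refine h.lifting_eq_zero_of_sign p 0 fun i j => ?_
    simp [rightOf, ((hx' i).2.trans_lt hX).not_gt, ((hx' j).2.trans_lt hX).not_gt]
  · refine h.lifting_eq_zero_of_sign p 1 fun i j => ?_
    have hi := hY.trans_le (hy' i).1
    have hj := hY.trans_le (hy' j).1
    unfold rightOf
    split_ifs with h1 h2 h2
    · simp
    · have : 0 ≤ crossDet x y i j p := by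
        unfold crossDet; nlinarith [not_lt.1 h2]
      simp [abs_of_nonneg this]
    · have : crossDet x y i j p ≤ 0 := by
        unfold crossDet; nlinarith [not_lt.1 h1]
      simp [abs_of_nonpos this]
    · simp
  · refine h.lifting_eq_zero_of_sign p (-1) fun i j => ?_
    have hi := (hy' i).2.trans_lt hY
    have hj := (hy' j).2.trans_lt hY
    unfold rightOf
    split_ifs with h1 h2 h2
    · simp
    · have : crossDet x y i j p ≤ 0 := by
        unfold crossDet; nlinarith [not_lt.1 h2]
      simp [abs_of_nonpos this]
    · have : 0 ≤ crossDet x y i j p := by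
        unfold crossDet; nlinarith [not_lt.1 h1]
      simp [abs_of_nonneg this]
    · simp

open Classical in
/-- The terms of the lifting split into those not involving `k` and those involving `k`. -/
theorem IsStress.lifting_eq_add (h : IsStress x y W) (k : ι) (p : ℝ × ℝ) :
    lifting x y W p = (∑ i ∈ {k}ᶜ, ∑ j ∈ {k}ᶜ, liftTerm x y W i j p) +
      2 * ∑ i ∈ {k}ᶜ, liftTerm x y W i k p := by
  have hs : ∀ g : ι → ℝ, ∑ i, g i = (∑ i ∈ {k}ᶜ, g i) + g k := fun g => by
    rw [← Finset.sum_compl_add_sum {k} g, Finset.sum_singleton]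
  rw [lifting, hs]
  simp_rw [hs (fun j => liftTerm x y W _ j p), Finset.sum_add_distrib, liftTerm_self,
    liftTerm_swap h.symm _ k]
  ring

open Classical in
/-- Below or above a vertex, the edges at that vertex contribute an affine function. -/
theorem IsStress.eventually_sum_liftTerm (h : IsStress x y W) (hinj : Function.Injective x)
    {k : ι} {p : ℝ × ℝ} (hX : x k = p.1) (hY : y k ≠ p.2) :
    ∃ c : ℝ, ∀ᶠ q in 𝓝 p, ∑ i ∈ {k}ᶜ, liftTerm x y W i k q =
      ∑ i, c * W i k * rightOf x p i * crossDet x y i k q := by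
  obtain ⟨c, hc1, hc⟩ : ∃ c : ℝ, |c| = 1 ∧ 0 < c * (y k - p.2) := by
    rcases lt_or_gt_of_ne hY with hY | hY
    · exact ⟨-1, by simp, by linarith⟩
    · exact ⟨1, by simp, by linarith⟩
  refine ⟨c, ?_⟩
  have key : ∀ i ∈ ({k}ᶜ : Finset ι), ∀ᶠ q in 𝓝 p, liftTerm x y W i k q =
      W i k * (c * (rightOf x p i - rightOf x q k) * crossDet x y i k q) := fun i hi => by
    have hi : x i ≠ p.1 := hX ▸ hinj.ne (by simpa using hi)
    have hD : crossDet x y i k p = (x i - p.1) * (y k - p.2) := by simp [crossDet, hX]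
    have hcont : Continuous fun q => c * crossDet x y i k q :=
      (continuous_crossDet i k).const_mul c
    have habs : ∀ z, |z| = |c * z| := fun z => by rw [abs_mul, hc1, one_mul]
    rcases lt_or_gt_of_ne hi with hi' | hi'
    · have hneg : c * crossDet x y i k p < 0 := by rw [hD]; nlinarith
      filter_upwards [eventually_rightOf hi, hcont.continuousAt.eventually_lt_const hneg]
        with q h1 h2
      have h0 : rightOf x p i = 0 := by simp [rightOf, not_lt_of_gt hi']
      rw [liftTerm, h1, h0, habs (crossDet x y i k q), abs_of_neg h2]
      rcases rightOf_eq_zero_or_one (x := x) q k with h3 | h3 <;> simp [h3]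
    · have hpos : 0 < c * crossDet x y i k p := by rw [hD]; nlinarith
      filter_upwards [eventually_rightOf hi, hcont.continuousAt.eventually_const_lt hpos]
        with q h1 h2
      have h0 : rightOf x p i = 1 := by simp [rightOf, hi']
      rw [liftTerm, h1, h0, habs (crossDet x y i k q), abs_of_pos h2]
      rcases rightOf_eq_zero_or_one (x := x) q k with h3 | h3 <;> simp [h3]
  filter_upwards [(Filter.eventually_all_finset _).2 key] with q hq
  have hsum : ∑ i, W i k * crossDet x y i k q = 0 := by
    rw [← neg_eq_zero, ← h.sum_crossDet k q, ← Finset.sum_neg_distrib]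
    refine Finset.sum_congr rfl fun i _ => ?_
    rw [h.symm, crossDet_swap k i]; ring
  rw [Finset.sum_congr rfl hq]
  calc _ = ∑ i, W i k * (c * (rightOf x p i - rightOf x q k) * crossDet x y i k q) := by
        rw [← Finset.sum_compl_add_sum {k}, Finset.sum_singleton]; simp
    _ = ∑ i, c * W i k * rightOf x p i * crossDet x y i k q -
          c * rightOf x q k * ∑ i, W i k * crossDet x y i k q := by
        rw [Finset.mul_sum, ← Finset.sum_sub_distrib]
        exact Finset.sum_congr rfl fun i _ => by ring
    _ = _ := by rw [hsum, mul_zero, sub_zero]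

open Classical in
theorem IsStress.continuousAt_sum_liftTerm (h : IsStress x y W) (hinj : Function.Injective x)
    {k : ι} {p : ℝ × ℝ} (hX : x k = p.1) :
    ContinuousAt (fun q => ∑ i ∈ {k}ᶜ, liftTerm x y W i k q) p := by
  by_cases hY : y k = p.2
  · refine tendsto_finsetSum _ fun i _ => ?_
    have h0 : crossDet x y i k p = 0 := by simp [crossDet, hX, hY]
    have h1 : Tendsto (fun q => |W i k| * |crossDet x y i k q|) (𝓝 p) (𝓝 0) := by
      have := ((continuous_crossDet (x := x) (y := y) i k).abs.const_mul |W i k|).tendsto p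
      simpa [h0] using this
    have h2 : liftTerm x y W i k p = 0 := by simp [liftTerm, h0]
    rw [h2]
    refine squeeze_zero_norm (fun q => ?_) h1
    rw [liftTerm, norm_mul, Real.norm_eq_abs, Real.norm_eq_abs]
    refine mul_le_mul_of_nonneg_left ?_ (abs_nonneg _)
    rw [abs_mul, abs_abs, abs_abs]
    refine mul_le_of_le_one_left (abs_nonneg _) ?_
    rcases rightOf_eq_zero_or_one (x := x) q k with h3 | h3 <;>
      rcases rightOf_eq_zero_or_one (x := x) q i with h4 | h4 <;> simp [h3, h4]
  · obtain ⟨c, hc⟩ := h.eventually_sum_liftTerm hinj hX hY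
    refine ContinuousAt.congr ?_ (hc.mono fun _ h => h.symm)
    exact (continuous_finsetSum _ fun i _ => (continuous_crossDet i k).const_mul _).continuousAt

theorem IsStress.continuous_lifting (h : IsStress x y W) (hinj : Function.Injective x) :
    Continuous (lifting x y W) := by
  classical
  refine continuous_iff_continuousAt.2 fun p => ?_
  by_cases hk : ∃ k, x k = p.1
  · obtain ⟨k, hk⟩ := hk
    have hne : ∀ i ∈ ({k}ᶜ : Finset ι), x i ≠ p.1 := fun i hi =>
      hk ▸ hinj.ne (by simpa using hi)
    rw [show lifting x y W = _ from funext (h.lifting_eq_add k)]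
    exact (tendsto_finsetSum _ fun i hi => tendsto_finsetSum _ fun j hj =>
      continuousAt_liftTerm (hne i hi) (hne j hj)).add
        ((h.continuousAt_sum_liftTerm hinj hk).const_mul 2)
  · push Not at hk
    exact tendsto_finsetSum _ fun i _ => tendsto_finsetSum _ fun j _ =>
      continuousAt_liftTerm (hk i) (hk j)

/-- At a point which is not a vertex, the lifting is balanced along every direction parallel to
the edges through that point. -/
theorem IsStress.locallyBalanced_lifting (h : IsStress x y W) (hinj : Function.Injective x)
    {p d : ℝ × ℝ} (hp : ∀ k, x k = p.1 → y k ≠ p.2)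
    (hd : ∀ i j, W i j ≠ 0 → Separates x i j p.1 → crossDet x y i j p = 0 →
      d.2 * (x j - x i) - d.1 * (y j - y i) = 0) :
    LocallyBalanced (lifting x y W) p d := by
  classical
  by_cases hk : ∃ k, x k = p.1
  · obtain ⟨k, hk⟩ := hk
    have hne : ∀ i ∈ ({k}ᶜ : Finset ι), x i ≠ p.1 := fun i hi =>
      hk ▸ hinj.ne (by simpa using hi)
    rw [show lifting x y W = _ from funext (h.lifting_eq_add k)]
    refine LocallyBalanced.add (LocallyBalanced.sum fun i hi => LocallyBalanced.sum fun j hj =>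
      locallyBalanced_liftTerm (hne i hi) (hne j hj) (hd i j)) (LocallyBalanced.const_mul ?_ 2)
    obtain ⟨c, hc⟩ := h.eventually_sum_liftTerm hinj hk (hp k hk)
    exact LocallyBalanced.congr (LocallyBalanced.sum fun i _ =>
      (locallyBalanced_crossDet i k p d).const_mul _) hc
  · push Not at hk
    exact LocallyBalanced.sum fun i _ => LocallyBalanced.sum fun j _ =>
      locallyBalanced_liftTerm (hk i) (hk j) (hd i j)

/-- At a vertex, the lifting is balanced along the boundary of the half-plane of pointedness. -/
theorem IsStress.locallyBalanced_lifting_vertex (h : IsStress x y W)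
    (hf : IsPointedFramework x y W) (k : ι) {d : ℝ × ℝ} (hd : d.1 ≠ 0)
    (hpos : ∀ j, W k j ≠ 0 → 0 < d.1 * (y j - y k) - d.2 * (x j - x k)) :
    LocallyBalanced (lifting x y W) (x k, y k) d := by
  classical
  have hne : ∀ i ∈ ({k}ᶜ : Finset ι), x i ≠ ((x k, y k) : ℝ × ℝ).1 := fun i hi =>
    hf.inj.ne (by simpa using hi)
  rw [show lifting x y W = _ from funext (h.lifting_eq_add k)]
  refine LocallyBalanced.add (LocallyBalanced.sum fun i hi => LocallyBalanced.sum fun j hj =>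
      locallyBalanced_liftTerm (hne i hi) (hne j hj) fun hW hs h0 =>
        absurd h0 (hf.avoid i j k hW hs)) (LocallyBalanced.const_mul ?_ 2)
  set p : ℝ × ℝ := (x k, y k) with hp
  have h0 : ∀ i, crossDet x y i k p = 0 := fun i => by simp [crossDet, hp]
  set e : ι → ℝ := fun i => d.1 * (y i - y k) - d.2 * (x i - x k) with he
  have hsum : ∑ i ∈ {k}ᶜ, W i k * e i = 0 := by
    have h1 : ∑ i, W i k * e i = 0 := by
      have : ∀ i, W i k * e i = d.1 * (W k i * (y i - y k)) - d.2 * (W k i * (x i - x k)) :=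
        fun i => by rw [h.symm i k, he]; ring
      simp_rw [this, Finset.sum_sub_distrib, ← Finset.mul_sum, h.sum_x, h.sum_y]
      simp
    rw [← h1, ← Finset.sum_compl_add_sum {k} (fun i => W i k * e i), Finset.sum_singleton]
    simp [he]
  have hev : ∀ i ∈ ({k}ᶜ : Finset ι), ∀ᶠ t : ℝ in 𝓝 0,
      liftTerm x y W i k (p + t • d) + liftTerm x y W i k (p - t • d) = |t| * (W i k * e i) := by
    intro i hi
    filter_upwards [(tendsto_add_smul p d).eventually (eventually_rightOf (hne i hi)),
      (tendsto_sub_smul p d).eventually (eventually_rightOf (hne i hi))] with t h1 h2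
    rw [liftTerm, liftTerm, h1, h2, crossDet_add_smul, crossDet_sub_smul, h0, zero_add, zero_sub,
      abs_neg]
    by_cases hW : W i k = 0
    · simp [hW]
    have hei : 0 < e i := hpos i (h.symm i k ▸ hW)
    have h3 : d.2 * (x k - x i) - d.1 * (y k - y i) = e i := by rw [he]; ring
    rw [h3, abs_mul, abs_of_pos hei]
    rcases eq_or_ne t 0 with rfl | ht
    · simp
    have h4 : |rightOf x p i - rightOf x (p + t • d) k| +
        |rightOf x p i - rightOf x (p - t • d) k| = 1 := by
      have htd : t * d.1 ≠ 0 := mul_ne_zero ht hd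
      have h5 : rightOf x (p + t • d) k + rightOf x (p - t • d) k = 1 := by
        rcases lt_or_gt_of_ne htd with h | h <;> simp [rightOf, hp, h, not_lt_of_gt h]
      rcases rightOf_eq_zero_or_one (x := x) (p + t • d) k with h6 | h6 <;>
        rcases rightOf_eq_zero_or_one (x := x) (p - t • d) k with h7 | h7 <;>
        rcases rightOf_eq_zero_or_one (x := x) p i with h8 | h8 <;>
        first | (norm_num [h6, h7] at h5; done) | norm_num [h6, h7, h8]
    linear_combination (W i k * |t| * e i) * h4
  filter_upwards [(Filter.eventually_all_finset _).2 hev] with t ht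
  rw [← Finset.sum_add_distrib, Finset.sum_congr rfl ht, ← Finset.mul_sum, hsum]
  simp [liftTerm, h0]

theorem IsStress.exists_locallyBalanced (h : IsStress x y W) (hf : IsPointedFramework x y W)
    (p : ℝ × ℝ) : ∃ d, d ≠ 0 ∧ LocallyBalanced (lifting x y W) p d := by
  by_cases hk : ∃ k, p = (x k, y k)
  · obtain ⟨k, rfl⟩ := hk
    obtain ⟨d, hd, hpos⟩ := hf.pointed k
    exact ⟨d, fun h0 => hd (by simp [h0]), h.locallyBalanced_lifting_vertex hf k hd hpos⟩
  have hp : ∀ k, x k = p.1 → y k ≠ p.2 := fun k h1 h2 => hk ⟨k, Prod.ext h1.symm h2.symm⟩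
  by_cases he : ∃ i j, W i j ≠ 0 ∧ Separates x i j p.1 ∧ crossDet x y i j p = 0
  · obtain ⟨i, j, hW, hs, h0⟩ := he
    refine ⟨(x j - x i, y j - y i), fun hd => ?_, h.locallyBalanced_lifting hf.inj hp ?_⟩
    · have := congrArg Prod.fst hd
      simp only [Prod.fst_zero] at this
      rcases hs with ⟨h1, h2⟩ | ⟨h1, h2⟩ <;> linarith
    · intro k l hW' hs' h0'
      have := hf.noncrossing i j k l p hW hW' hs hs' h0 h0'
      rcases Sym2.eq_iff.1 this with ⟨rfl, rfl⟩ | ⟨rfl, rfl⟩ <;> ring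
  · push Not at he
    exact ⟨(1, 0), by simp, h.locallyBalanced_lifting hf.inj hp fun i j h1 h2 h3 =>
      absurd h3 (he i j h1 h2)⟩

theorem IsStress.lifting_nonpos (h : IsStress x y W) (hf : IsPointedFramework x y W)
    (p : ℝ × ℝ) : lifting x y W p ≤ 0 := by
  by_contra! hpos
  obtain ⟨R, hR⟩ : ∃ R, ∀ i, |x i| ≤ R ∧ |y i| ≤ R := by
    obtain ⟨R, hR⟩ := (Set.finite_range fun i => max |x i| |y i|).bddAbove
    exact ⟨R, fun i => max_le_iff.1 (hR ⟨i, rfl⟩)⟩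
  set K : Set (ℝ × ℝ) := Set.Icc (-R) R ×ˢ Set.Icc (-R) R
  have hK : IsCompact K := isCompact_Icc.prod isCompact_Icc
  have hout : ∀ q, lifting x y W q ≠ 0 → q ∈ K := fun q hq => by
    by_contra hn
    exact hq (h.lifting_eq_zero (fun i => (hR i).1) (fun i => (hR i).2) hn)
  have hc := h.continuous_lifting hf.inj
  obtain ⟨m, hm, hmax⟩ := hK.exists_isMaxOn ⟨p, hout p hpos.ne'⟩ hc.continuousOn
  have hm0 : 0 < lifting x y W m := hpos.trans_le (hmax (hout p hpos.ne'))
  have hle : ∀ q, lifting x y W q ≤ lifting x y W m := fun q => by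
    by_cases hq : lifting x y W q = 0
    · rw [hq]; exact hm0.le
    · exact hmax (hout q hq)
  have hA : IsCompact {q | lifting x y W q = lifting x y W m} :=
    hK.of_isClosed_subset (isClosed_eq hc continuous_const)
      fun q (hq : lifting x y W q = _) => hout q (hq ▸ hm0.ne')
  have hn : Continuous fun q : ℝ × ℝ => q.1 ^ 2 + q.2 ^ 2 := by fun_prop
  obtain ⟨z, hz, hzmax⟩ := hA.exists_isMaxOn ⟨m, rfl⟩ hn.continuousOn
  have hz : lifting x y W z = lifting x y W m := hz
  obtain ⟨d, hd, hbal⟩ := h.exists_locallyBalanced hf z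
  obtain ⟨t, ht, ht0⟩ :=
    ((hbal.filter_mono nhdsWithin_le_nhds).and (self_mem_nhdsWithin (a := 0) (s := {0}ᶜ))).exists
  have h1 := hle (z + t • d)
  have h2 := hle (z - t • d)
  rw [hz] at ht
  have h3 := hzmax (a := z + t • d) (show lifting x y W _ = _ by linarith)
  have h4 := hzmax (a := z - t • d) (show lifting x y W _ = _ by linarith)
  simp only [Set.mem_ofPred_eq, Prod.fst_add, Prod.snd_add, Prod.fst_sub, Prod.snd_sub,
    Prod.smul_fst, Prod.smul_snd, smul_eq_mul] at h3 h4
  have ht2 : 0 < t ^ 2 := by positivity [show t ≠ 0 from ht0]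
  have h5 : t ^ 2 * (d.1 ^ 2 + d.2 ^ 2) ≤ 0 := by nlinarith
  have h6 : d.1 ^ 2 + d.2 ^ 2 ≤ 0 := nonpos_of_mul_nonpos_right h5 ht2
  exact hd (Prod.ext (by simp; nlinarith [sq_nonneg d.1, sq_nonneg d.2])
    (by simp; nlinarith [sq_nonneg d.1, sq_nonneg d.2]))

theorem IsStress.lifting_eq_zero_of_pointed (h : IsStress x y W) (hf : IsPointedFramework x y W)
    (p : ℝ × ℝ) : lifting x y W p = 0 := by
  have := h.neg.lifting_nonpos hf.neg p
  rw [lifting_neg] at this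
  linarith [h.lifting_nonpos hf p]

/-- A non-crossing pointed framework carries no nonzero equilibrium stress. -/
theorem IsStress.eq_zero (h : IsStress x y W) (hf : IsPointedFramework x y W) (i j : ι)
    (hij : x i < x j) : W i j = 0 := by
  classical
  by_contra hW
  obtain ⟨X, hX, hXn⟩ := (Set.Ioo_infinite hij).exists_notMem_finset (Finset.univ.image x)
  have hne : ∀ k, x k ≠ X := by simpa using hXn
  set p : ℝ × ℝ := (X, y i + (X - x i) * ((y j - y i) / (x j - x i)))
  have hs : Separates x i j p.1 := Or.inl hX
  have hD : crossDet x y i j p = 0 := by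
    have : x j - x i ≠ 0 := by linarith
    simp only [crossDet, p]; field_simp; ring
  have hterm : ∀ k l, ∃ c : ℝ, 0 ≤ c ∧ (k = i → l = j → 0 < c) ∧ ∀ᶠ t : ℝ in 𝓝 0,
      liftTerm x y W k l (p + t • (0, 1)) + liftTerm x y W k l (p - t • (0, 1)) =
        2 * liftTerm x y W k l p + W i j * (c * |t|) := by
    intro k l
    by_cases hkl : W k l ≠ 0 ∧ Separates x k l p.1 ∧ crossDet x y k l p = 0
    · obtain ⟨h1, h2, h3⟩ := hkl
      have hkl : W k l = W i j := by
        rcases Sym2.eq_iff.1 (hf.noncrossing i j k l p hW h1 hs h2 hD h3) with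
          ⟨rfl, rfl⟩ | ⟨rfl, rfl⟩
        exacts [rfl, h.symm _ _]
      refine ⟨2 * |x l - x k|, by positivity, ?_, ?_⟩
      · rintro rfl rfl
        have : x l - x k ≠ 0 := by linarith
        positivity
      have hev := eventually_liftTerm (x := x) (y := y) (W := W) (p := p) (hne k) (hne l)
      filter_upwards [(tendsto_add_smul p (0, 1)).eventually hev,
        (tendsto_sub_smul p (0, 1)).eventually hev] with t h4 h5
      rw [h4, h5, hev.self_of_nhds, h2.abs_rightOf, crossDet_add_smul, crossDet_sub_smul, h3, hkl]
      simp [abs_mul]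
      ring
    · refine ⟨0, le_rfl, ?_, ?_⟩
      · rintro rfl rfl; exact absurd ⟨hW, hs, hD⟩ hkl
      have := locallyBalanced_liftTerm (x := x) (y := y) (W := W) (p := p) (d := (0, 1))
        (hne k) (hne l) fun h1 h2 h3 => absurd ⟨h1, h2, h3⟩ hkl
      simpa [LocallyBalanced] using this
  choose c hc0 hcpos hc using hterm
  have hall : ∀ᶠ t : ℝ in 𝓝 0, ∀ k l, liftTerm x y W k l (p + t • (0, 1)) +
      liftTerm x y W k l (p - t • (0, 1)) = 2 * liftTerm x y W k l p + W i j * (c k l * |t|) :=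
    Filter.eventually_all.2 fun k => Filter.eventually_all.2 fun l => hc k l
  obtain ⟨t, ht, ht0⟩ :=
    ((hall.filter_mono nhdsWithin_le_nhds).and (self_mem_nhdsWithin (a := 0) (s := {0}ᶜ))).exists
  have hsum : lifting x y W (p + t • (0, 1)) + lifting x y W (p - t • (0, 1)) =
      2 * lifting x y W p + W i j * ((∑ k, ∑ l, c k l) * |t|) := by
    simp only [lifting, Finset.mul_sum, Finset.sum_mul, ← Finset.sum_add_distrib, ht]
  simp only [h.lifting_eq_zero_of_pointed hf, add_zero, mul_zero, zero_add] at hsum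
  have hpos : 0 < ∑ k, ∑ l, c k l :=
    Finset.sum_pos' (fun k _ => Finset.sum_nonneg fun l _ => hc0 k l) ⟨i, Finset.mem_univ _,
      Finset.sum_pos' (fun l _ => hc0 i l) ⟨j, Finset.mem_univ _, hcpos i j rfl rfl⟩⟩
  have ht1 : |t| ≠ 0 := abs_ne_zero.2 ht0
  exact mul_ne_zero hW (mul_ne_zero hpos.ne' ht1) hsum.symm

end Stress

section Existence

open Classical in
/-- The symmetric weights on pairs of vertices given by weights on the edges in `T`. -/
noncomputable def edgeWeight {ι : Type*} (T : Finset (Sym2 ι)) :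
    (T → ℝ) →ₗ[ℝ] ι → ι → ℝ where
  toFun w i j := if h : s(i, j) ∈ T then w ⟨s(i, j), h⟩ else 0
  map_add' v w := by ext i j; by_cases h : s(i, j) ∈ T <;> simp [h]
  map_smul' c w := by ext i j; by_cases h : s(i, j) ∈ T <;> simp [h]

open Classical in
theorem edgeWeight_symm {ι : Type*} (T : Finset (Sym2 ι)) (w : T → ℝ) (i j : ι) :
    edgeWeight T w i j = edgeWeight T w j i :=
  congrArg (fun s => if h : s ∈ T then w ⟨s, h⟩ else 0) Sym2.eq_swap

theorem edgeWeight_mem {ι : Type*} {T : Finset (Sym2 ι)} {w : T → ℝ} {i j : ι}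
    (h : edgeWeight T w i j ≠ 0) : s(i, j) ∈ T := by
  by_contra hn
  exact h (by simp [edgeWeight, hn])

/-- The force exerted at the `i`-th vertex, in the coordinate `z`. -/
noncomputable def force {ι : Type*} [Fintype ι] (z : ι → ℝ) (i : ι) : (ι → ι → ℝ) →ₗ[ℝ] ℝ where
  toFun W := ∑ j, W i j * (z j - z i)
  map_add' V W := by simp [add_mul, Finset.sum_add_distrib]
  map_smul' c W := by simp [mul_assoc, Finset.mul_sum]

theorem force_apply {ι : Type*} [Fintype ι] (z : ι → ℝ) (i : ι) (W : ι → ι → ℝ) :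
    force z i W = ∑ j, W i j * (z j - z i) := rfl

theorem sum_sum_eq_zero_of_antisymm {ι : Type*} [Fintype ι] {g : ι → ι → ℝ}
    (hg : ∀ i j, g i j = -g j i) : ∑ i, ∑ j, g i j = 0 := by
  have : ∑ i, ∑ j, g i j = -∑ i, ∑ j, g i j := by
    conv_lhs => rw [Finset.sum_comm]
    simp_rw [← Finset.sum_neg_distrib]
    exact Finset.sum_congr rfl fun i _ => Finset.sum_congr rfl fun j _ => hg j i
  linarith

theorem sum_force {ι : Type*} [Fintype ι] (z : ι → ℝ) {W : ι → ι → ℝ}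
    (hW : ∀ i j, W i j = W j i) : ∑ i, force z i W = 0 :=
  sum_sum_eq_zero_of_antisymm fun i j => by rw [hW i j]; ring

theorem sum_moment {ι : Type*} [Fintype ι] (x y : ι → ℝ) {W : ι → ι → ℝ}
    (hW : ∀ i j, W i j = W j i) : ∑ i, (x i * force y i W - y i * force x i W) = 0 := by
  simp_rw [force_apply, Finset.mul_sum, ← Finset.sum_sub_distrib]
  exact sum_sum_eq_zero_of_antisymm fun i j => by rw [hW i j]; ring

/-- A framework on `m + 2` vertices with more than `2 m + 1` edges carries a nonzero stress. -/
theorem exists_stress_of_card_lt {m : ℕ} {x y : Fin (m + 2) → ℝ} (hinj : Function.Injective x)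
    {T : Finset (Sym2 (Fin (m + 2)))} (hT : 2 * m + 1 < T.card) :
    ∃ w : T → ℝ, w ≠ 0 ∧ IsStress x y (edgeWeight T w) := by
  let L : (T → ℝ) →ₗ[ℝ] (Fin (m + 1) → ℝ) × (Fin m → ℝ) :=
    (LinearMap.prod (LinearMap.pi fun i => force x i.succ)
      (LinearMap.pi fun i => force y i.succ.succ)).comp (edgeWeight T)
  have hL : LinearMap.ker L ≠ ⊥ := LinearMap.ker_ne_bot_of_finrank_lt (by
    simp only [Module.finrank_prod, Module.finrank_fintype_fun_eq_card, Fintype.card_fin,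
      Fintype.card_coe]
    omega)
  obtain ⟨w, hw, hw0⟩ := (Submodule.ne_bot_iff _).1 hL
  have hsymm := edgeWeight_symm T w
  have hx : ∀ i : Fin (m + 1), force x i.succ (edgeWeight T w) = 0 := fun i =>
    congrFun (congrArg Prod.fst (LinearMap.mem_ker.1 hw)) i
  have hy : ∀ i : Fin m, force y i.succ.succ (edgeWeight T w) = 0 := fun i =>
    congrFun (congrArg Prod.snd (LinearMap.mem_ker.1 hw)) i
  have hx0 : force x 0 (edgeWeight T w) = 0 := by
    simpa [Fin.sum_univ_succ, hx] using sum_force x hsymm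
  have hx' : ∀ i, force x i (edgeWeight T w) = 0 := Fin.cases hx0 hx
  have h1 : force y 0 (edgeWeight T w) + force y 1 (edgeWeight T w) = 0 := by
    simpa [Fin.sum_univ_succ, hy] using sum_force y hsymm
  have h2 : x 0 * force y 0 (edgeWeight T w) + x 1 * force y 1 (edgeWeight T w) = 0 := by
    simpa [Fin.sum_univ_succ, hy, hx'] using sum_moment x y hsymm
  have h01 : x 0 - x 1 ≠ 0 := sub_ne_zero.2 (hinj.ne (by simp))
  have h3 : force y 0 (edgeWeight T w) = 0 :=
    (mul_eq_zero.1 (show (x 0 - x 1) * force y 0 (edgeWeight T w) = 0 by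
      linear_combination h2 - x 1 * h1)).resolve_left h01
  have h4 : force y 1 (edgeWeight T w) = 0 := by linarith
  exact ⟨w, hw0, hsymm, hx', Fin.cases h3 (Fin.cases h4 hy)⟩

end Existence

/-- Finitely many nonzero vectors of the plane admit a shear giving all of them a nonzero first
coordinate. -/
theorem exists_shear {κ : Type*} [Finite κ] (v : κ → ℝ × ℝ) (hv : ∀ k, v k ≠ 0) :
    ∃ c : ℝ, ∀ k, (v k).1 + c * (v k).2 ≠ 0 := by
  obtain ⟨c, hc⟩ := (Set.finite_range fun k => -(v k).1 / (v k).2).exists_notMem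
  refine ⟨c, fun k hk => ?_⟩
  by_cases h2 : (v k).2 = 0
  · exact hv k (Prod.ext (by simpa [h2] using hk) h2)
  · exact hc ⟨k, by field_simp; linarith⟩

/-- A point on the line through two points, whose abscissa lies strictly between theirs, is a
convex combination of them. -/
theorem Separates.exists_lineMap {ι : Type*} {x y : ι → ℝ} {i j : ι} {p : ℝ × ℝ}
    (hs : Separates x i j p.1) (h0 : crossDet x y i j p = 0) :
    ∃ t ∈ Set.Icc (0 : ℝ) 1, p.1 = (1 - t) * x i + t * x j ∧ p.2 = (1 - t) * y i + t * y j := by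
  have hne : x j - x i ≠ 0 := by rcases hs with h | h <;> intro <;> linarith
  unfold crossDet at h0
  refine ⟨(p.1 - x i) / (x j - x i), ⟨?_, ?_⟩, ?_, ?_⟩
  · rcases hs with h | h
    · exact div_nonneg (by linarith) (by linarith)
    · exact div_nonneg_of_nonpos (by linarith) (by linarith)
  · rcases hs with h | h
    · exact (div_le_one (by linarith)).2 (by linarith)
    · exact (div_le_one_of_neg (by linarith)).2 (by linarith)
  · field_simp; ring
  · field_simp; linear_combination h0

theorem lineMap_mem_convexHull_image {ι E : Type*} [AddCommGroup E] [Module ℝ E] (a : ι → E)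
    (i j : ι) {t : ℝ} (ht : t ∈ Set.Icc (0 : ℝ) 1) :
    (1 - t) • a i + t • a j ∈ convexHull ℝ (a '' {k | k ∈ s(i, j)}) :=
  convex_convexHull ℝ _ (subset_convexHull ℝ _ (Set.mem_image_of_mem a (Sym2.mem_mk_left i j)))
    (subset_convexHull ℝ _ (Set.mem_image_of_mem a (Sym2.mem_mk_right i j))) (by linarith [ht.2]) ht.1 (by ring)

theorem Separates.notMem {ι : Type*} {x : ι → ℝ} {i j k : ι} (hs : Separates x i j (x k)) :
    k ∉ s(i, j) := by
  rw [Sym2.mem_iff]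
  rintro (rfl | rfl) <;> rcases hs with h | h <;> linarith [h.1, h.2]

/-- A direction along which a linear functional on the plane vanishes. -/
theorem exists_boundary_direction (φ : EuclideanSpace ℝ (Fin 2) →ₗ[ℝ] ℝ) :
    ∃ d : ℝ × ℝ, d ≠ 0 ∧ ∀ w, 0 < φ w → 0 < d.1 * w 1 - d.2 * w 0 := by
  have hφ : ∀ w, φ w = w 0 * φ (EuclideanSpace.single 0 1) +
      w 1 * φ (EuclideanSpace.single 1 1) := fun w => by
    have hw : w = w 0 • EuclideanSpace.single 0 1 + w 1 • EuclideanSpace.single 1 1 := by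
      ext i; fin_cases i <;> simp
    conv_lhs => rw [hw]
    simp
  by_cases h : ((φ (EuclideanSpace.single 1 1), -φ (EuclideanSpace.single 0 1)) : ℝ × ℝ) = 0
  · refine ⟨(1, 0), by simp, fun w hw => ?_⟩
    simp only [Prod.mk_eq_zero, neg_eq_zero] at h
    rw [hφ, h.1, h.2] at hw
    simp at hw
  · refine ⟨_, h, fun w hw => ?_⟩
    rw [hφ] at hw
    linarith

/-- **Upper bound on the number of edges of a non-crossing pointed set of segments.**
Let `a : Fin (n+1) → ℝ²` be an injective family of points (`n ≥ 1`), and let `T` be a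
finite set of unordered pairs of distinct indices, thought of as the straight segments
between the corresponding points.  Assume that the segments avoid the other marked
points, that they pairwise intersect only at common endpoints, and that at every point
the incident segments point into an open half-plane.  Then `T` has at most `2n - 1`
elements. -/
theorem edges_upper_bound (n : ℕ) (hn : 1 ≤ n)
    (a : Fin (n + 1) → EuclideanSpace ℝ (Fin 2))
    (ha : Function.Injective a)
    (T : Finset (Sym2 (Fin (n + 1))))
    (hndiag : ∀ s ∈ T, ¬ s.IsDiag)
    (hint : ∀ s ∈ T, ∀ k, k ∉ s →
      a k ∉ convexHull ℝ (a '' {i | i ∈ s}))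
    (hcross : ∀ s ∈ T, ∀ t ∈ T, s ≠ t → ∀ p,
      p ∈ convexHull ℝ (a '' {i | i ∈ s}) → p ∈ convexHull ℝ (a '' {i | i ∈ t}) →
      ∃ m, m ∈ s ∧ m ∈ t ∧ p = a m)
    (hpointed : ∀ i, ∃ φ : EuclideanSpace ℝ (Fin 2) →ₗ[ℝ] ℝ,
      ∀ j, s(i, j) ∈ T → 0 < φ (a j - a i)) :
    T.card ≤ 2 * n - 1 := by
  obtain ⟨m, rfl⟩ := Nat.exists_eq_add_of_le' hn
  by_contra! hcard
  choose φ hφ using hpointed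
  choose d hd0 hd using fun k => exists_boundary_direction (φ k)
  obtain ⟨c, hc⟩ := exists_shear
    (Sum.elim (fun e : {e : Fin (m + 1 + 1) × Fin (m + 1 + 1) // e.1 ≠ e.2} =>
      ((a e.1.1 0 - a e.1.2 0, a e.1.1 1 - a e.1.2 1) : ℝ × ℝ)) d) (by
    rintro (⟨⟨i, j⟩, hij⟩ | k)
    · intro h
      simp only [Sum.elim_inl, Prod.mk_eq_zero, sub_eq_zero] at h
      exact hij (ha (by ext l; fin_cases l; exacts [h.1, h.2]))
    · exact hd0 k)
  set x : Fin (m + 1 + 1) → ℝ := fun i => a i 0 + c * a i 1 with hx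
  set y : Fin (m + 1 + 1) → ℝ := fun i => a i 1 with hy
  have hinj : Function.Injective x := fun i j hij => by
    by_contra hne
    refine hc (Sum.inl ⟨(i, j), hne⟩) ?_
    simp only [hx] at hij
    simp only [Sum.elim_inl]
    linarith
  have hpoint : ∀ (q : EuclideanSpace ℝ (Fin 2)) i j t (p : ℝ × ℝ),
      p.1 = (1 - t) * x i + t * x j → p.2 = (1 - t) * y i + t * y j →
      q 0 + c * q 1 = p.1 → q 1 = p.2 → q = (1 - t) • a i + t • a j := by
    intro q i j t p h1 h2 h3 h4
    have h5 : q 1 = (1 - t) * a i 1 + t * a j 1 := h4.trans h2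
    have h6 : q 0 = (1 - t) * a i 0 + t * a j 0 := by
      simp only [hx] at h1
      linear_combination h3 + h1 - c * h5
    ext l
    fin_cases l
    · simpa using h6
    · simpa using h5
  obtain ⟨w, hw0, hstress⟩ := exists_stress_of_card_lt (y := y) hinj (T := T) (by omega)
  have hframe : IsPointedFramework x y (edgeWeight T w) := by
    refine ⟨hinj, fun i j k hW hs h0 => ?_, fun i j k l p hW hW' hs hs' h0 h0' => ?_, fun k => ?_⟩
    · obtain ⟨t, ht, h1, h2⟩ := hs.exists_lineMap (p := (x k, y k)) h0
      refine hint _ (edgeWeight_mem hW) k hs.notMem ?_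
      rw [hpoint (a k) i j t _ h1 h2 rfl rfl]
      exact lineMap_mem_convexHull_image a i j ht
    · by_contra hne
      obtain ⟨t, ht, h1, h2⟩ := hs.exists_lineMap h0
      obtain ⟨t', ht', h1', h2'⟩ := hs'.exists_lineMap h0'
      let q : EuclideanSpace ℝ (Fin 2) := !₂[p.1 - c * p.2, p.2]
      have hq := hpoint q i j t p h1 h2 (by simp [q]) (by simp [q])
      have hq' := hpoint q k l t' p h1' h2' (by simp [q]) (by simp [q])
      obtain ⟨r, hr, -, hqr⟩ := hcross _ (edgeWeight_mem hW) _ (edgeWeight_mem hW') hne q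
        (hq ▸ lineMap_mem_convexHull_image a i j ht)
        (hq' ▸ lineMap_mem_convexHull_image a k l ht')
      have hpr : p.1 = x r := by simp [hx, ← hqr, q]
      exact (hpr ▸ hs).notMem hr
    · refine ⟨((d k).1 + c * (d k).2, (d k).2), hc (Sum.inr k), fun j hW => ?_⟩
      have := hd k _ (hφ k j (edgeWeight_mem hW))
      simp only [PiLp.sub_apply] at this
      simp only [hx, hy]
      linarith
  refine hw0 (funext fun ⟨s, hs⟩ => ?_)
  induction s using Sym2.ind with
  | _ i j =>
    have hij : i ≠ j := hndiag _ hs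
    have hW : edgeWeight T w i j = 0 := by
      rcases lt_or_gt_of_ne (hinj.ne hij) with h | h
      · exact hstress.eq_zero hframe i j h
      · rw [hstress.symm]; exact hstress.eq_zero hframe j i h
    simpa [edgeWeight, hs] using hW
end
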